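/- Let dS₂ = {x ∈ ℝ³ : x₁² + x₂² − x₃² = 1} be the 2-dimensional de Sitter space, let SO(2,1) = {A ∈ SL₃(ℝ) : Aᵀ J A = J} with J = diag(1,1,−1), acting on dS₂ by matrix multiplication, and let Γ be a discrete subgroup of SO(2,1) of finite covolume. Then there exists a nonzero SO(2,1)-invariant Radon measure ν on dS₂ such that for every φ ∈ L¹(dS₂, ν) with compact support and for ν-almost every x ∈ dS₂: (1/t) Σ_{γ ∈ Γ, log‖γ‖ ≤ t} φ(γ⁻¹ x) → ∫_{dS₂} φ dν as t → ∞, where ‖γ‖ denotes the Euclidean (Frobenius) norm of the matrix γ. -/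

import Mathlib

open MeasureTheory Filter Matrix
open scoped ENNReal

noncomputable section

/-- `SLR d` denotes SL_{d+1}(ℝ). -/
abbrev SLR (d : ℕ) := Matrix.SpecialLinearGroup (Fin (d+1)) ℝ

instance (d : ℕ) : TopologicalSpace (SLR d) :=
  inferInstanceAs (TopologicalSpace {A : Matrix (Fin (d+1)) (Fin (d+1)) ℝ // A.det = 1})

instance (d : ℕ) : MeasurableSpace (SLR d) := borel _

/-- The matrix J = diag(1,…,1,−1) of the standard Lorentz form on ℝ^{d+1}. -/
def lorentzForm (d : ℕ) : Matrix (Fin (d+1)) (Fin (d+1)) ℝ :=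
  Matrix.diagonal fun i => if (i : ℕ) < d then 1 else -1

/-- The group SO(d,1) = {A ∈ SL_{d+1}(ℝ) : Aᵀ J A = J}. -/
def lorentzGroup (d : ℕ) : Subgroup (SLR d) where
  carrier := {S | (S : Matrix (Fin (d+1)) (Fin (d+1)) ℝ)ᵀ * lorentzForm d * S = lorentzForm d}
  one_mem' := by
    simp [Matrix.SpecialLinearGroup.coe_one]
  mul_mem' := by
    intro A B hA hB
    have hA' : (A : Matrix (Fin (d+1)) (Fin (d+1)) ℝ)ᵀ * lorentzForm d * A = lorentzForm d := hA
    have hB' : (B : Matrix (Fin (d+1)) (Fin (d+1)) ℝ)ᵀ * lorentzForm d * B = lorentzForm d := hB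
    show ((A * B : SLR d) : Matrix (Fin (d+1)) (Fin (d+1)) ℝ)ᵀ * lorentzForm d * (A * B : SLR d) = lorentzForm d
    rw [Matrix.SpecialLinearGroup.coe_mul, Matrix.transpose_mul]
    calc (B : Matrix (Fin (d+1)) (Fin (d+1)) ℝ)ᵀ * (A : Matrix (Fin (d+1)) (Fin (d+1)) ℝ)ᵀ
          * lorentzForm d * ((A : Matrix (Fin (d+1)) (Fin (d+1)) ℝ) * B)
        = (B : Matrix (Fin (d+1)) (Fin (d+1)) ℝ)ᵀ *
            ((A : Matrix (Fin (d+1)) (Fin (d+1)) ℝ)ᵀ * lorentzForm d * A) * B := by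
          simp only [Matrix.mul_assoc]
      _ = lorentzForm d := by rw [hA', hB']
  inv_mem' := by
    intro A hA
    have hA' : (A : Matrix (Fin (d+1)) (Fin (d+1)) ℝ)ᵀ * lorentzForm d * A = lorentzForm d := hA
    set C : Matrix (Fin (d+1)) (Fin (d+1)) ℝ := ((A⁻¹ : SLR d) : Matrix (Fin (d+1)) (Fin (d+1)) ℝ) with hC
    show Cᵀ * lorentzForm d * C = lorentzForm d
    have hAB : (A : Matrix (Fin (d+1)) (Fin (d+1)) ℝ) * C = 1 := by
      rw [hC, ← Matrix.SpecialLinearGroup.coe_mul, mul_inv_cancel, Matrix.SpecialLinearGroup.coe_one]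
    calc Cᵀ * lorentzForm d * C
        = Cᵀ * ((A : Matrix (Fin (d+1)) (Fin (d+1)) ℝ)ᵀ * lorentzForm d * A) * C := by
          rw [hA']
      _ = ((A : Matrix (Fin (d+1)) (Fin (d+1)) ℝ) * C)ᵀ * lorentzForm d *
            ((A : Matrix (Fin (d+1)) (Fin (d+1)) ℝ) * C) := by
          simp only [Matrix.transpose_mul, Matrix.mul_assoc]
      _ = lorentzForm d := by rw [hAB]; simp

/-- The d-dimensional de Sitter space dS_d = {x ∈ ℝ^{d+1} : x₁² + ⋯ + x_d² − x_{d+1}² = 1}. -/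
def deSitter (d : ℕ) : Set (Fin (d+1) → ℝ) :=
  {x | (∑ i : Fin (d+1), if (i : ℕ) < d then x i ^ 2 else -(x i ^ 2)) = 1}

/-- The Euclidean (Frobenius) norm of a square matrix. -/
def frobNorm {k : ℕ} (A : Matrix (Fin k) (Fin k) ℝ) : ℝ :=
  Real.sqrt (∑ i, ∑ j, (A i j) ^ 2)

/-- The matrix of an element of a subgroup Γ of the Lorentz group. -/
def lmat {d : ℕ} {Γ : Subgroup ↥(lorentzGroup d)} (γ : ↥Γ) :
    Matrix (Fin (d+1)) (Fin (d+1)) ℝ :=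
  (((γ : ↥(lorentzGroup d)) : SLR d) : Matrix (Fin (d+1)) (Fin (d+1)) ℝ)

section
open MeasureTheory Filter Matrix
open scoped ENNReal

section birk
set_option linter.unusedSectionVars false
variable {X : Type*} [MeasurableSpace X] {μ : Measure X}

/-- The maximal function used in the maximal ergodic theorem. -/
noncomputable def maxErg (T : X → X) (G : X → ℝ) : ℕ → X → ℝ
  | 0 => fun _ => 0
  | n+1 => fun x => max 0 (G x + maxErg T G n (T x))

lemma maxErg_nonneg (T : X → X) (G : X → ℝ) (n : ℕ) (x : X) : 0 ≤ maxErg T G n x := by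
  cases n with
  | zero => simp [maxErg]
  | succ n => simp [maxErg]

lemma maxErg_mono (T : X → X) (G : X → ℝ) (n : ℕ) (x : X) :
    maxErg T G n x ≤ maxErg T G (n+1) x := by
  induction n generalizing x with
  | zero => exact maxErg_nonneg T G 1 x
  | succ n ih =>
    simp only [maxErg]
    have := ih (T x)
    simp only [maxErg] at this
    exact max_le_max le_rfl (by linarith)

lemma birk_le_maxErg (T : X → X) (G : X → ℝ) (n : ℕ) (x : X) :
    ∑ k ∈ Finset.range n, G (T^[k] x) ≤ maxErg T G n x := by
  induction n generalizing x with
  | zero => simp [maxErg]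
  | succ n ih =>
    rw [Finset.sum_range_succ']
    have := ih (T x)
    simp only [maxErg, Function.iterate_succ_apply, Function.iterate_zero, id]
    exact le_max_of_le_right (by linarith)

lemma maxErg_integrable {T : X → X} (hT : MeasurePreserving T μ μ) {G : X → ℝ}
    (hG : Integrable G μ) (n : ℕ) : Integrable (maxErg T G n) μ := by
  induction n with
  | zero => exact integrable_zero _ _ _
  | succ n ih =>
    have h1 : Integrable (fun x => G x + maxErg T G n (T x)) μ :=
      hG.add (hT.integrable_comp_of_integrable ih)
    exact (integrable_zero X ℝ μ).sup h1

lemma maximal_ergodic {T : X → X} (hT : MeasurePreserving T μ μ) {G : X → ℝ}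
    (hG : Integrable G μ)
    (hpos : ∀ᵐ x ∂μ, ∃ n, 0 < ∑ k ∈ Finset.range n, G (T^[k] x)) :
    0 ≤ ∫ x, G x ∂μ := by
  set h : ℕ → X → ℝ := fun n x => maxErg T G (n+1) x - maxErg T G n (T x) with hh
  have hintegr : ∀ n, 0 ≤ ∫ x, h n x ∂μ := by
    intro n
    have i1 := maxErg_integrable hT hG (n+1)
    have i0 := maxErg_integrable hT hG n
    have i2 : Integrable (fun x => maxErg T G n (T x)) μ := hT.integrable_comp_of_integrable i0
    rw [hh]
    simp only
    rw [integral_sub i1 i2]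
    have : ∫ x, maxErg T G n (T x) ∂μ = ∫ x, maxErg T G n x ∂μ := by
      have := integral_map (μ := μ) hT.measurable.aemeasurable (f := maxErg T G n)
        (by rw [hT.map_eq]; exact i0.aestronglyMeasurable)
      rw [hT.map_eq] at this
      exact this.symm
    rw [this]
    have := integral_mono i0 i1 (fun x => maxErg_mono T G n x)
    linarith
  have hlim : Tendsto (fun n => ∫ x, h n x ∂μ) atTop (nhds (∫ x, G x ∂μ)) := by
    refine tendsto_integral_of_dominated_convergence (fun x => |G x|) ?_ hG.abs ?_ ?_
    · intro n
      exact ((maxErg_integrable hT hG (n+1)).sub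
        (hT.integrable_comp_of_integrable (maxErg_integrable hT hG n))).aestronglyMeasurable
    · intro n
      refine Eventually.of_forall fun x => ?_
      simp only [hh, maxErg, Real.norm_eq_abs]
      have h0 := maxErg_nonneg T G n (T x)
      rcases max_cases 0 (G x + maxErg T G n (T x)) with ⟨e, h1⟩ | ⟨e, h1⟩
      · rw [e, abs_of_nonpos (by linarith)]
        have := neg_abs_le (G x)
        linarith
      · rw [e]; simp
    · filter_upwards [hpos] with x ⟨n, hn⟩
      refine tendsto_const_nhds.congr' ?_
      filter_upwards [eventually_ge_atTop n] with k hk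
      have h1 : 0 < maxErg T G (k+1) x :=
        lt_of_lt_of_le (lt_of_lt_of_le hn (birk_le_maxErg T G n x))
          (monotone_nat_of_le_succ (f := fun n => maxErg T G n x)
            (fun n => maxErg_mono T G n x) (by omega))
      simp only [hh]
      simp only [maxErg] at h1 ⊢
      rw [lt_max_iff] at h1
      rw [max_eq_right (by rcases h1 with h1 | h1 <;> linarith)]
      ring
  exact ge_of_tendsto' hlim hintegr

lemma birk_upper [IsFiniteMeasure μ] {T W : X → X} (hT : MeasurePreserving T μ μ)
    (hcomm : ∀ x, T (W x) = W (T x))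
    (herg : ∀ s : Set X, MeasurableSet s → T ⁻¹' s = s → W ⁻¹' s = s → μ s = 0 ∨ μ sᶜ = 0)
    {F : X → ℝ} (hFm : Measurable F) (hF : Integrable F μ) (hFW : ∀ x, F (W x) = F x)
    {α : ℝ} (hα : ∫ x, F x ∂μ < α * μ.real Set.univ) :
    ∀ᵐ x ∂μ, ∃ C : ℝ, ∀ n : ℕ, ∑ k ∈ Finset.range n, F (T^[k] x) ≤ α * n + C := by
  set S : ℕ → X → ℝ := fun n x => ∑ k ∈ Finset.range n, F (T^[k] x) with hS
  have hSm : ∀ n, Measurable (S n) := fun n =>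
    Finset.measurable_sum _ fun k _ => hFm.comp (hT.measurable.iterate k)
  set E : Set X := {x | ∃ C : ℕ, ∀ n : ℕ, S n x ≤ α * n + C} with hE
  have hEm : MeasurableSet E := by
    have : E = ⋃ C : ℕ, ⋂ n : ℕ, {x | S n x ≤ α * n + C} := by
      ext x; simp [hE]
    rw [this]
    exact MeasurableSet.iUnion fun C => MeasurableSet.iInter fun n =>
      measurableSet_le (hSm n) measurable_const
  have hrec : ∀ n x, S (n+1) x = F x + S n (T x) := by
    intro n x
    simp only [hS]
    rw [Finset.sum_range_succ', add_comm]
    simp [Function.iterate_succ_apply]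
  have hET : T ⁻¹' E = E := by
    ext x
    simp only [Set.mem_preimage, hE, Set.mem_ofPred_eq]
    constructor
    · rintro ⟨C, hC⟩
      obtain ⟨C', hC'⟩ := exists_nat_ge (|F x| + |α| + C)
      refine ⟨C', fun n => ?_⟩
      cases n with
      | zero => simp [hS]
      | succ n =>
        rw [hrec]
        have := hC n
        have := le_abs_self (F x)
        have := neg_abs_le α
        push_cast
        linarith
    · rintro ⟨C, hC⟩
      obtain ⟨C', hC'⟩ := exists_nat_ge (|F x| + |α| + C)
      refine ⟨C', fun n => ?_⟩
      have h1 := hC (n+1)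
      rw [hrec] at h1
      have := neg_abs_le (F x)
      have := le_abs_self α
      push_cast at h1
      linarith
  have hWit : ∀ k x, F (T^[k] (W x)) = F (T^[k] x) := by
    intro k x
    have : T^[k] (W x) = W (T^[k] x) := by
      induction k with
      | zero => rfl
      | succ k ih => rw [Function.iterate_succ_apply', ih, hcomm, Function.iterate_succ_apply']
    rw [this, hFW]
  have hEW : W ⁻¹' E = E := by
    ext x
    simp only [Set.mem_preimage, hE, Set.mem_ofPred_eq, hS, hWit]
  rcases herg E hEm hET hEW with h | h
  · exfalso
    have hintegr : Integrable (fun x => F x - α) μ := hF.sub (integrable_const α)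
    have := maximal_ergodic hT hintegr ?_
    · rw [integral_sub hF (integrable_const α), integral_const, smul_eq_mul] at this
      linarith
    · have h' : ∀ᵐ x ∂μ, x ∉ E := measure_eq_zero_iff_ae_notMem.1 h
      filter_upwards [h'] with x hx
      simp only [hE, Set.mem_ofPred_eq, not_exists, not_forall, not_le] at hx
      obtain ⟨n, hn⟩ := hx 0
      refine ⟨n, ?_⟩
      rw [Finset.sum_sub_distrib]
      simp only [hS] at hn
      simp
      push_cast at hn
      linarith
  · have h' : ∀ᵐ x ∂μ, x ∈ E := h
    filter_upwards [h'] with x hx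
    obtain ⟨C, hC⟩ := hx
    exact ⟨C, hC⟩

theorem birk_ergodic [IsFiniteMeasure μ] (hμ : μ ≠ 0) {T W : X → X} (hT : MeasurePreserving T μ μ)
    (hcomm : ∀ x, T (W x) = W (T x))
    (herg : ∀ s : Set X, MeasurableSet s → T ⁻¹' s = s → W ⁻¹' s = s → μ s = 0 ∨ μ sᶜ = 0)
    {F : X → ℝ} (hFm : Measurable F) (hF : Integrable F μ) (hFW : ∀ x, F (W x) = F x) :
    ∀ᵐ x ∂μ, Tendsto (fun n : ℕ => (∑ k ∈ Finset.range n, F (T^[k] x)) / n) atTop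
      (nhds ((∫ x, F x ∂μ) / μ.real Set.univ)) := by
  set A := (∫ x, F x ∂μ) / μ.real Set.univ with hA
  have hM : 0 < μ.real Set.univ := by
    rw [Measure.real, ENNReal.toReal_pos_iff]
    exact ⟨Measure.measure_univ_pos.2 hμ, measure_lt_top _ _⟩
  have up : ∀ (F : X → ℝ), Measurable F → Integrable F μ → (∀ x, F (W x) = F x) →
      ∀ᵐ x ∂μ, ∀ j : ℕ, ∃ C : ℝ, ∀ n : ℕ, ∑ k ∈ Finset.range n, F (T^[k] x) ≤
        ((∫ x, F x ∂μ) / μ.real Set.univ + 1/((j:ℝ)+1)) * n + C := by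
    intro F hFm hF hFW
    rw [ae_all_iff]
    intro j
    refine birk_upper hT hcomm herg hFm hF hFW ?_
    rw [add_mul, div_mul_cancel₀ _ hM.ne']
    have : 0 < 1 / ((j:ℝ)+1) * μ.real Set.univ := by positivity
    linarith
  have key : ∀ (S : ℕ → ℝ) (B : ℝ), (∀ j : ℕ, ∃ C : ℝ, ∀ n : ℕ, S n ≤ (B + 1/((j:ℝ)+1)) * n + C) →
      ∀ ε > 0, ∀ᶠ n : ℕ in atTop, S n / n < B + ε := by
    intro S B h ε hε
    obtain ⟨j, hj⟩ := exists_nat_one_div_lt (half_pos hε)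
    obtain ⟨C, hC⟩ := h j
    have : Tendsto (fun n : ℕ => C / (n:ℝ)) atTop (nhds 0) := tendsto_const_div_atTop_nhds_zero_nat C
    filter_upwards [eventually_gt_atTop 0, this.eventually_lt_const (half_pos hε)] with n hn hCn
    have hn' : (0:ℝ) < n := by exact_mod_cast hn
    have h1 : S n / n ≤ (B + 1/((j:ℝ)+1)) + C / n := by
      rw [div_le_iff₀ hn', add_mul, div_mul_cancel₀ _ hn'.ne']
      exact hC n
    linarith
  have hneg := up (fun x => - F x) hFm.neg hF.neg (fun x => by simp [hFW])
  filter_upwards [up F hFm hF hFW, hneg] with x h1 h2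
  rw [integral_neg, neg_div, ← hA] at h2
  rw [← hA] at h1
  have k1 := key _ _ h1
  have k2 := key _ _ h2
  rw [Metric.tendsto_nhds]
  intro ε hε
  filter_upwards [k1 ε hε, k2 ε hε] with n a1 a2
  simp only [Finset.sum_neg_distrib, neg_div] at a2
  rw [Real.dist_eq, abs_lt]
  constructor <;> linarith

end birk

end

section
open MeasureTheory Filter Matrix
open scoped ENNReal

section abs
set_option linter.unusedSectionVars false
variable {G : Type*} [Group G] [TopologicalSpace G] [IsTopologicalGroup G] [PolishSpace G]
  [LocallyCompactSpace G] [MeasurableSpace G] [BorelSpace G]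

open scoped Pointwise in
lemma mk_preimage_op_smul (Γ : Subgroup G) (t : Set (G ⧸ Γ)) (g : Γ.op) :
    g • ((QuotientGroup.mk : G → G ⧸ Γ) ⁻¹' t) = (QuotientGroup.mk : G → G ⧸ Γ) ⁻¹' t := by
  ext x
  rw [Set.mem_smul_set_iff_inv_smul_mem]
  simp only [Set.mem_preimage]
  have : (QuotientGroup.mk (g⁻¹ • x) : G ⧸ Γ) = QuotientGroup.mk x := by
    rw [eq_comm, QuotientGroup.eq]
    have hg := g⁻¹.2
    rw [Subgroup.mem_op] at hg
    have : x⁻¹ * (g⁻¹ • x) = MulOpposite.unop ((g⁻¹ : Γ.op) : Gᵐᵒᵖ) := by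
      rw [Subgroup.smul_def, MulOpposite.smul_eq_mul_unop]
      group
    rw [this]
    exact hg
  rw [this]

/-- Mautner phenomenon: sets invariant under `a` and `w` in `G ⧸ Γ` are null or conull. -/
theorem mautner_sets (Γ : Subgroup G) [DiscreteTopology Γ] (m : Measure G) [m.IsHaarMeasure]
    [m.IsMulRightInvariant] {D : Set G} (hDom : IsFundamentalDomain Γ.op D m) (hfin : m D < ⊤)
    (a w : G)
    (hgen : ∀ S : Subgroup G, a ∈ S → w ∈ S →
      (∀ u : G, Tendsto (fun n : ℕ => a ^ n * u * (a ^ n)⁻¹) atTop (nhds 1) → u ∈ S) →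
      (∀ u : G, Tendsto (fun n : ℕ => (a ^ n)⁻¹ * u * a ^ n) atTop (nhds 1) → u ∈ S) → S = ⊤) :
    SMulInvariantMeasure G (G ⧸ Γ) (Measure.map (QuotientGroup.mk : G → G ⧸ Γ) (m.restrict D)) ∧
    ∀ s : Set (G ⧸ Γ), MeasurableSet s → (a • ·) ⁻¹' s = s → (w • ·) ⁻¹' s = s →
      (Measure.map (QuotientGroup.mk : G → G ⧸ Γ) (m.restrict D)) s = 0 ∨ 
      (Measure.map (QuotientGroup.mk : G → G ⧸ Γ) (m.restrict D)) sᶜ = 0 := by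
  have hcl : IsClosed (Γ : Set G) := Subgroup.isClosed_of_discrete
  have : Countable Γ := by
    have : SecondCountableTopology Γ := inferInstance
    exact TopologicalSpace.separableSpace_iff_countable.1 inferInstance
  have : T3Space (G ⧸ Γ) := inferInstance
  have : SecondCountableTopology (G ⧸ Γ) := inferInstance
  have : BorelSpace (G ⧸ Γ) := inferInstance
  set μ := (Measure.map (QuotientGroup.mk : G → G ⧸ Γ) (m.restrict D)) with hμ
  have hq : QuotientMeasureEqMeasurePreimage m μ :=
    hDom.quotientMeasureEqMeasurePreimage_quotientMeasure
  have : HasFundamentalDomain Γ.op G m := ⟨⟨D, hDom⟩⟩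
  have hinv : SMulInvariantMeasure G (G ⧸ Γ) μ :=
    MeasureTheory.QuotientMeasureEqMeasurePreimage.smulInvariantMeasure_quotient m
  refine ⟨hinv, fun s hs ha hw => ?_⟩
  have hfinr : IsFiniteMeasure (m.restrict D) := ⟨by simpa using hfin⟩
  have hfinμ : IsFiniteMeasure μ := Measure.isFiniteMeasure_map _ _
  have : μ.InnerRegularCompactLTTop := inferInstance
  have hp : Fact ((2:ℝ≥0∞) ≠ ⊤) := ⟨by simp⟩
  set f : Lp ℝ 2 μ := indicatorConstLp 2 hs (measure_ne_top _ _) (1:ℝ) with hf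
  have hfix : ∀ g : G, (g • ·) ⁻¹' s = s → DomMulAct.mk g • f = f := by
    intro g hg
    rw [hf, DomMulAct.mk_smul_indicatorConstLp]
    congr
  let S : Subgroup G :=
    { carrier := {g | DomMulAct.mk g • f = f}
      one_mem' := by simp
      mul_mem' := by
        intro x y hx hy
        simp only [Set.mem_ofPred_eq] at hx hy ⊢
        rw [DomMulAct.mk_mul, mul_smul, hx, hy]
      inv_mem' := by
        intro x hx
        simp only [Set.mem_ofPred_eq] at hx ⊢
        rw [DomMulAct.mk_inv, inv_smul_eq_iff, hx] }
  have hSmem : ∀ g, g ∈ S ↔ DomMulAct.mk g • f = f := fun g => Iff.rfl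
  have mau : ∀ (b : G), b ∈ S → ∀ u : G,
      Tendsto (fun n : ℕ => b ^ n * u * (b ^ n)⁻¹) atTop (nhds 1) → u ∈ S := by
    intro b hb u hu
    have hcont : Continuous fun g : G => DomMulAct.mk g • f :=
      (DomMulAct.continuous_mk).smul continuous_const
    have h1 := (hcont.tendsto 1).comp hu
    simp only [DomMulAct.mk_one, one_smul] at h1
    have hbn : ∀ n : ℕ, DomMulAct.mk (b^n) • f = f := fun n => (hSmem _).1 (S.pow_mem hb n)
    have h2 : ∀ n : ℕ, dist (DomMulAct.mk u • f) f =
        dist (DomMulAct.mk (b ^ n * u * (b ^ n)⁻¹) • f) f := by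
      intro n
      rw [DomMulAct.mk_mul, DomMulAct.mk_mul, DomMulAct.mk_inv, mul_smul, mul_smul, hbn]
      rw [← dist_smul (DomMulAct.mk (b^n)) (_⁻¹ • _) f, smul_inv_smul, hbn]
    have h3 : Tendsto (fun n : ℕ => dist (DomMulAct.mk (b ^ n * u * (b ^ n)⁻¹) • f) f) atTop
        (nhds 0) := by
      have := h1.dist (tendsto_const_nhds (x := f))
      simpa using this
    simp_rw [← h2] at h3
    have := tendsto_nhds_unique h3 tendsto_const_nhds
    rw [hSmem]
    exact dist_eq_zero.1 this.symm
  have hST : S = ⊤ := by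
    refine hgen S (hfix a ha) (hfix w hw) (mau a (hfix a ha)) ?_
    intro u hu
    refine mau a⁻¹ (S.inv_mem (hfix a ha)) u ?_
    simpa using hu
  have hae : ∀ g : G, (g • ·) ⁻¹' s =ᵐ[μ] s := by
    intro g
    have h1 : DomMulAct.mk g • f = f := (hSmem g).1 (hST ▸ Subgroup.mem_top g)
    rw [hf, DomMulAct.mk_smul_indicatorConstLp] at h1
    exact (indicatorConstLp_inj _ _ _ _ one_ne_zero).1 h1
  -- pull back to G
  have hnull : ∀ t : Set (G ⧸ Γ), MeasurableSet t →
      (μ t = 0 ↔ m ((QuotientGroup.mk : G → G ⧸ Γ) ⁻¹' t) = 0) := by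
    intro t ht
    have hmk : Measurable (QuotientGroup.mk : G → G ⧸ Γ) := continuous_quotient_mk'.measurable
    rw [hμ, Measure.map_apply hmk ht, Measure.restrict_apply (hmk ht)]
    constructor
    · intro h
      exact hDom.measure_zero_of_invariant _ (mk_preimage_op_smul Γ _) h
    · intro h
      exact measure_mono_null Set.inter_subset_left h
  set s' := (QuotientGroup.mk : G → G ⧸ Γ) ⁻¹' s with hs'
  have hs'm : MeasurableSet s' := (continuous_quotient_mk'.measurable : Measurable (QuotientGroup.mk : G → G ⧸ Γ)) hs
  have hae' : ∀ g : G, (g • ·) ⁻¹' s' =ᵐ[m] s' := by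
    intro g
    have h1 := hae g
    have hgs : MeasurableSet ((g • · : G ⧸ Γ → G ⧸ Γ) ⁻¹' s) := (measurable_const_smul g) hs
    rw [ae_eq_set] at h1 ⊢
    rw [hnull _ (hgs.diff hs), hnull _ (hs.diff hgs)] at h1
    exact h1
  have hconst := aeconst_of_forall_preimage_smul_ae_eq G hs'm.nullMeasurableSet hae'
  rw [eventuallyConst_set'] at hconst
  rcases hconst with h | h
  · left
    rw [hnull s hs]
    exact ae_eq_empty.1 h
  · right
    rw [hnull _ hs.compl]
    exact ae_eq_univ.1 h

theorem count_disc (Γ : Subgroup G) [DiscreteTopology Γ] : Countable Γ :=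
  TopologicalSpace.separableSpace_iff_countable.1 inferInstance

theorem abstract_average (Γ : Subgroup G) [DiscreteTopology Γ] (m : Measure G) [m.IsHaarMeasure]
    [m.IsMulRightInvariant] {D : Set G} (hDom : IsFundamentalDomain Γ.op D m) (hfin : m D < ⊤)
    (a w : G) (haw : a * w = w * a)
    (hgen : ∀ S : Subgroup G, a ∈ S → w ∈ S →
      (∀ u : G, Tendsto (fun n : ℕ => a ^ n * u * (a ^ n)⁻¹) atTop (nhds 1) → u ∈ S) →
      (∀ u : G, Tendsto (fun n : ℕ => (a ^ n)⁻¹ * u * a ^ n) atTop (nhds 1) → u ∈ S) → S = ⊤)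
    (f : G → ℝ≥0∞) (hf : Measurable f) (hfi : ∫⁻ g, f g ∂m ≠ ⊤) (hfw : ∀ g, f (w * g) = f g) :
    ∀ᵐ y ∂m, Tendsto (fun N : ℕ => (∑ n ∈ Finset.range N, ∑' γ : Γ, f (a ^ n * y * γ)) / N) atTop
      (nhds ((∫⁻ g, f g ∂m) / m D)) := by
  have hcl : IsClosed (Γ : Set G) := Subgroup.isClosed_of_discrete
  have : Countable Γ := count_disc Γ
  have : T3Space (G ⧸ Γ) := inferInstance
  have : SecondCountableTopology (G ⧸ Γ) := inferInstance
  have : BorelSpace (G ⧸ Γ) := inferInstance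
  obtain ⟨hinv, herg⟩ := mautner_sets Γ m hDom hfin a w hgen
  have hmk : Measurable (QuotientGroup.mk : G → G ⧸ Γ) := continuous_quotient_mk'.measurable
  set μ := (Measure.map (QuotientGroup.mk : G → G ⧸ Γ) (m.restrict D)) with hμ
  have hfinr : IsFiniteMeasure (m.restrict D) := ⟨by simpa using hfin⟩
  have hfinμ : IsFiniteMeasure μ := Measure.isFiniteMeasure_map _ _
  have hDne : m D ≠ 0 := hDom.measure_ne_zero (NeZero.ne m)
  have hμu : μ Set.univ = m D := by
    rw [hμ, Measure.map_apply hmk MeasurableSet.univ]; simp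
  have hμ0 : μ ≠ 0 := by
    intro h; rw [h] at hμu; exact hDne (by simpa using hμu.symm)
  set F0 : G → ℝ≥0∞ := fun y => ∑' γ : Γ, f (y * γ) with hF0
  have hF0m : Measurable F0 :=
    Measurable.tsum fun γ => hf.comp (measurable_mul_const _)
  set F : G ⧸ Γ → ℝ≥0∞ := Quotient.lift F0 (by
    intro x y hxy
    have h : x⁻¹ * y ∈ Γ := QuotientGroup.leftRel_apply.1 hxy
    simp only [hF0]
    rw [← (Equiv.mulLeft (⟨x⁻¹ * y, h⟩ : Γ)).tsum_eq]
    refine tsum_congr fun γ => ?_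
    simp [mul_assoc]) with hF
  have hFmk : ∀ y : G, F (QuotientGroup.mk y) = F0 y := fun y => rfl
  have hFm : Measurable F := measurable_from_quotient.2 hF0m
  have hFint : ∫⁻ x, F x ∂μ = ∫⁻ g, f g ∂m := by
    rw [hμ, lintegral_map hFm hmk, hDom.lintegral_eq_tsum'', ← lintegral_tsum]
    · refine lintegral_congr fun y => ?_
      rw [hFmk]
      simp only [hF0]
      rw [← (Subgroup.equivOp Γ).tsum_eq]
      rfl
    · intro g
      exact (hf.comp (measurable_const_smul g)).aemeasurable
  have hFfin : ∀ᵐ x ∂μ, F x < ⊤ := ae_lt_top hFm (by rw [hFint]; exact hfi)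
  have hFreal : Integrable (fun x => (F x).toReal) μ :=
    integrable_toReal_of_lintegral_ne_top hFm.aemeasurable (by rw [hFint]; exact hfi)
  have hT : MeasurePreserving (fun x : G ⧸ Γ => a • x) μ μ := measurePreserving_smul a μ
  have hb := birk_ergodic hμ0 (T := fun x : G ⧸ Γ => a • x) (W := fun x => w • x) hT
    (fun x => by simp only [← mul_smul, haw]) herg (F := fun x => (F x).toReal)
    hFm.ennreal_toReal hFreal (by
      intro x
      induction x using QuotientGroup.induction_on with
      | H y =>
        show (F0 (w * y)).toReal = (F0 y).toReal
        simp only [hF0, mul_assoc, hfw])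
  have hfinorb : ∀ᵐ x ∂μ, ∀ n : ℕ, F (a ^ n • x) < ⊤ := by
    rw [ae_all_iff]
    intro n
    exact (measurePreserving_smul (a ^ n) μ).quasiMeasurePreserving.ae hFfin
  have hfinal : ∀ᵐ x ∂μ, Tendsto (fun N : ℕ => (∑ n ∈ Finset.range N, F (a ^ n • x)) / N) atTop
      (nhds ((∫⁻ g, f g ∂m) / m D)) := by
    filter_upwards [hb, hfinorb] with x h1 h2
    have h3 := ENNReal.tendsto_ofReal h1
    rw [integral_toReal hFm.aemeasurable hFfin, hFint, Measure.real, hμu,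
      ← ENNReal.toReal_div, ENNReal.ofReal_toReal (ENNReal.div_ne_top hfi hDne)] at h3
    refine h3.congr' ?_
    filter_upwards [eventually_gt_atTop 0] with N hN
    rw [ENNReal.ofReal_div_of_pos (by exact_mod_cast hN), ENNReal.ofReal_natCast]
    congr 1
    rw [ENNReal.ofReal_sum_of_nonneg (fun _ _ => ENNReal.toReal_nonneg)]
    refine Finset.sum_congr rfl fun n _ => ?_
    rw [smul_iterate]
    exact ENNReal.ofReal_toReal (h2 n).ne
  -- pull back to `G`
  have hset : MeasurableSet {x : G ⧸ Γ | Tendsto (fun N : ℕ =>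
      (∑ n ∈ Finset.range N, F (a ^ n • x)) / N) atTop (nhds ((∫⁻ g, f g ∂m) / m D))} := by
    refine measurableSet_tendsto _ fun N => ?_
    refine Measurable.div_const ?_ _
    exact Finset.measurable_sum _ fun n _ => hFm.comp (measurable_const_smul _)
  have h0 : m ((QuotientGroup.mk : G → G ⧸ Γ) ⁻¹' {x : G ⧸ Γ | Tendsto (fun N : ℕ =>
      (∑ n ∈ Finset.range N, F (a ^ n • x)) / N) atTop (nhds ((∫⁻ g, f g ∂m) / m D))}ᶜ) = 0 := by
    refine hDom.measure_zero_of_invariant _ (mk_preimage_op_smul Γ _) ?_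
    have h1 : μ {x : G ⧸ Γ | Tendsto (fun N : ℕ =>
      (∑ n ∈ Finset.range N, F (a ^ n • x)) / N) atTop (nhds ((∫⁻ g, f g ∂m) / m D))}ᶜ = 0 :=
      hfinal
    rw [ hμ, Measure.map_apply hmk hset.compl, Measure.restrict_apply (hmk hset.compl)] at h1
    exact h1
  have h1 : ∀ᵐ y ∂m, y ∉ ((QuotientGroup.mk : G → G ⧸ Γ) ⁻¹' {x : G ⧸ Γ | Tendsto (fun N : ℕ =>
      (∑ n ∈ Finset.range N, F (a ^ n • x)) / N) atTop (nhds ((∫⁻ g, f g ∂m) / m D))}ᶜ) :=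
    measure_eq_zero_iff_ae_notMem.1 h0
  filter_upwards [h1] with y hy
  have hy' : Tendsto (fun N : ℕ =>
      (∑ n ∈ Finset.range N, F (a ^ n • (QuotientGroup.mk y : G ⧸ Γ))) / N) atTop
        (nhds ((∫⁻ g, f g ∂m) / m D)) := by
    by_contra h
    exact hy h
  exact hy'

end abs

end

abbrev LG := ↥(lorentzGroup 2)

instance slrTop : IsTopologicalGroup (SLR 2) where
  continuous_inv := continuous_induced_rng.mpr continuous_induced_dom.matrix_adjugate
  continuous_mul := continuous_induced_rng.mpr <|
    (continuous_induced_dom.comp continuous_fst).mul (continuous_induced_dom.comp continuous_snd)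

instance : BorelSpace (SLR 2) := ⟨rfl⟩

def mat (g : LG) : Matrix (Fin 3) (Fin 3) ℝ := (g : SLR 2).1

lemma mat_mul (g h : LG) : mat (g * h) = mat g * mat h := rfl
lemma mat_one : mat 1 = 1 := rfl
lemma mat_inj {g h : LG} (H : mat g = mat h) : g = h := Subtype.ext (Subtype.ext H)

lemma lorentz_eq : lorentzForm 2 = !![1,0,0;0,1,0;0,0,-1] := by
  ext i j
  fin_cases i <;> fin_cases j <;> simp [lorentzForm, Matrix.diagonal]

lemma mat_form (g : LG) : (mat g)ᵀ * !![1,0,0;0,1,0;0,0,-1] * mat g = !![1,0,0;0,1,0;0,0,-1] := by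
  have : (mat g)ᵀ * lorentzForm 2 * mat g = lorentzForm 2 := g.2
  rwa [lorentz_eq] at this

lemma mat_det (g : LG) : (mat g).det = 1 := (g : SLR 2).2

lemma mat_closedEmbedding : Topology.IsClosedEmbedding mat := by
  have h1 : Topology.IsClosedEmbedding (fun g : SLR 2 => g.1) := 
    (isClosed_singleton.preimage continuous_id.matrix_det).isClosedEmbedding_subtypeVal
  have h2 : IsClosed ((lorentzGroup 2 : Set (SLR 2))) := by
    have hc : Continuous (fun g : SLR 2 => g.1) := h1.continuous
    exact isClosed_eq (by fun_prop) continuous_const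
  exact h1.comp h2.isClosedEmbedding_subtypeVal

instance : PolishSpace (Matrix (Fin 3) (Fin 3) ℝ) :=
  inferInstanceAs (PolishSpace (Fin 3 → Fin 3 → ℝ))
instance : LocallyCompactSpace (Matrix (Fin 3) (Fin 3) ℝ) :=
  inferInstanceAs (LocallyCompactSpace (Fin 3 → Fin 3 → ℝ))
instance : T2Space LG := mat_closedEmbedding.isEmbedding.t2Space
instance : PolishSpace LG := mat_closedEmbedding.polishSpace
instance : LocallyCompactSpace LG := mat_closedEmbedding.locallyCompactSpace
example : BorelSpace LG := inferInstance
example : IsTopologicalGroup LG := inferInstance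

lemma cont_mat : Continuous mat := mat_closedEmbedding.continuous
lemma cont_entry (i j : Fin 3) : Continuous fun g : LG => mat g i j :=
  cont_mat.matrix_elem i j

lemma compact_frob (R : ℝ) : IsCompact {g : LG | frobNorm (mat g) ≤ R} := by
  have : IsCompact {M : Matrix (Fin 3) (Fin 3) ℝ | frobNorm M ≤ R} := by
    have hK : IsCompact (Set.pi Set.univ (fun _ : Fin 3 => Set.pi Set.univ fun _ : Fin 3 => Set.Icc (-R) R)) :=
      isCompact_univ_pi fun _ => isCompact_univ_pi fun _ => isCompact_Icc
    refine IsCompact.of_isClosed_subset (X := Fin 3 → Fin 3 → ℝ) hK ?_ ?_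
    · refine isClosed_le ?_ continuous_const
      unfold frobNorm
      fun_prop
    · intro M hM i _ j _
      have h1 : (M i j)^2 ≤ ∑ i, ∑ j, (M i j)^2 := by
        refine (Finset.single_le_sum (f := fun j => (M i j)^2) (fun j _ => sq_nonneg _) (Finset.mem_univ j)).trans ?_
        exact Finset.single_le_sum (f := fun i => ∑ j, (M i j)^2) (fun i _ => Finset.sum_nonneg fun j _ => sq_nonneg _) (Finset.mem_univ i)
      have h2 : |M i j| ≤ R := (Real.abs_le_sqrt h1).trans hM
      exact abs_le.1 h2
  exact mat_closedEmbedding.isCompact_preimage this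

/-- Build an element of SO(2,1) from a matrix. -/
def mkL (M : Matrix (Fin 3) (Fin 3) ℝ) (h1 : M.det = 1)
    (h2 : Mᵀ * !![1,0,0;0,1,0;0,0,-1] * M = !![1,0,0;0,1,0;0,0,-1]) : LG :=
  ⟨⟨M, h1⟩, by
    show Mᵀ * lorentzForm 2 * M = lorentzForm 2
    rw [lorentz_eq]; exact h2⟩

def uP (t : ℝ) : LG := mkL !![1,t,t; -t,1-t^2/2,-(t^2/2); t,t^2/2,1+t^2/2]
  (by rw [Matrix.det_fin_three]; simp; ring)
  (by ext i j; fin_cases i <;> fin_cases j <;>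
        simp [Matrix.mul_apply, Fin.sum_univ_three] <;> ring)

def uM (t : ℝ) : LG := mkL !![1,t,-t; -t,1-t^2/2,t^2/2; -t,-(t^2/2),1+t^2/2]
  (by rw [Matrix.det_fin_three]; simp; ring)
  (by ext i j; fin_cases i <;> fin_cases j <;>
        simp [Matrix.mul_apply, Fin.sum_univ_three] <;> ring)

def aE (s : ℝ) : LG := mkL !![1,0,0;0,Real.cosh s,Real.sinh s;0,Real.sinh s,Real.cosh s]
  (by rw [Matrix.det_fin_three]; simp; linarith [Real.cosh_sq s])
  (by
    have := Real.cosh_sq s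
    ext i j; fin_cases i <;> fin_cases j <;>
        simp [Matrix.mul_apply, Fin.sum_univ_three] <;> linarith)

def wE : LG := mkL !![1,0,0;0,-1,0;0,0,-1]
  (by rw [Matrix.det_fin_three]; simp)
  (by ext i j; fin_cases i <;> fin_cases j <;>
        simp [Matrix.mul_apply, Fin.sum_univ_three])

lemma mat_uP (t : ℝ) : mat (uP t) = !![1,t,t; -t,1-t^2/2,-(t^2/2); t,t^2/2,1+t^2/2] := rfl
lemma mat_uM (t : ℝ) : mat (uM t) = !![1,t,-t; -t,1-t^2/2,t^2/2; -t,-(t^2/2),1+t^2/2] := rfl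
lemma mat_aE (s : ℝ) :
  mat (aE s) = !![1,0,0;0,Real.cosh s,Real.sinh s;0,Real.sinh s,Real.cosh s] := rfl
lemma mat_wE : mat wE = !![1,0,0;0,-1,0;0,0,-1] := rfl

lemma aE_add (s t : ℝ) : aE s * aE t = aE (s + t) := by
  apply mat_inj
  rw [mat_mul, mat_aE, mat_aE, mat_aE, Real.cosh_add, Real.sinh_add]
  ext i j; fin_cases i <;> fin_cases j <;>
        simp [Matrix.mul_apply, Fin.sum_univ_three] <;> ring

lemma aE_zero : aE 0 = 1 := by
  apply mat_inj
  rw [mat_aE, mat_one]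
  ext i j; fin_cases i <;> fin_cases j <;> simp

lemma aE_inv (s : ℝ) : (aE s)⁻¹ = aE (-s) := by
  rw [inv_eq_iff_mul_eq_one, aE_add]; simp [aE_zero]

lemma aE_pow (s : ℝ) (n : ℕ) : (aE s) ^ n = aE (n * s) := by
  induction n with
  | zero => simp [aE_zero]
  | succ n ih => rw [pow_succ, ih, aE_add]; push_cast; congr 1; ring

lemma aE_zpow (s : ℝ) (n : ℤ) : (aE s) ^ n = aE (n * s) := by
  cases n with
  | ofNat n => simp [aE_pow]
  | negSucc n =>
    rw [zpow_negSucc, aE_pow, aE_inv]; push_cast; congr 1; ring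

lemma aE_wE (s : ℝ) : aE s * wE = wE * aE s := by
  apply mat_inj
  rw [mat_mul, mat_mul, mat_aE, mat_wE]
  ext i j; fin_cases i <;> fin_cases j <;>
        simp [Matrix.mul_apply, Fin.sum_univ_three]

lemma wE_sq : wE * wE = 1 := by
  apply mat_inj
  rw [mat_mul, mat_wE, mat_one]
  ext i j; fin_cases i <;> fin_cases j <;>
        simp [Matrix.mul_apply, Fin.sum_univ_three]

lemma uP_add (s t : ℝ) : uP s * uP t = uP (s + t) := by
  apply mat_inj
  rw [mat_mul, mat_uP, mat_uP, mat_uP]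
  ext i j; fin_cases i <;> fin_cases j <;>
        simp [Matrix.mul_apply, Fin.sum_univ_three] <;> ring

lemma uM_add (s t : ℝ) : uM s * uM t = uM (s + t) := by
  apply mat_inj
  rw [mat_mul, mat_uM, mat_uM, mat_uM]
  ext i j; fin_cases i <;> fin_cases j <;>
        simp [Matrix.mul_apply, Fin.sum_univ_three] <;> ring

lemma aE_uP (s t : ℝ) : aE (-s) * uP t * aE s = uP (t * Real.exp s) := by
  have h1 : Real.cosh s = (Real.exp s + (Real.exp s)⁻¹)/2 := by rw [Real.cosh_eq, Real.exp_neg]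
  have h2 : Real.sinh s = (Real.exp s - (Real.exp s)⁻¹)/2 := by rw [Real.sinh_eq, Real.exp_neg]
  have h3 := Real.exp_pos s
  apply mat_inj
  rw [mat_mul, mat_mul, mat_uP, mat_uP, mat_aE, mat_aE, Real.cosh_neg, Real.sinh_neg, h1, h2]
  set e := Real.exp s
  ext i j; fin_cases i <;> fin_cases j <;>
        simp [Matrix.mul_apply, Fin.sum_univ_three] <;> field_simp <;> ring

lemma aE_uM (s t : ℝ) : aE (-s) * uM t * aE s = uM (t * Real.exp (-s)) := by
  have h1 : Real.cosh s = (Real.exp s + (Real.exp s)⁻¹)/2 := by rw [Real.cosh_eq, Real.exp_neg]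
  have h2 : Real.sinh s = (Real.exp s - (Real.exp s)⁻¹)/2 := by rw [Real.sinh_eq, Real.exp_neg]
  have h3 := Real.exp_pos s
  apply mat_inj
  rw [mat_mul, mat_mul, mat_uM, mat_uM, mat_aE, mat_aE, Real.cosh_neg, Real.sinh_neg, h1, h2,
    Real.exp_neg]
  set e := Real.exp s
  ext i j; fin_cases i <;> fin_cases j <;>
        simp [Matrix.mul_apply, Fin.sum_univ_three] <;> field_simp <;> ring

lemma uP_cont : Continuous uP := by
  rw [mat_closedEmbedding.isInducing.continuous_iff]
  refine continuous_matrix fun i j => ?_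
  simp only [Function.comp_apply, mat_uP]
  fin_cases i <;> fin_cases j <;> simp <;> fun_prop

lemma uM_cont : Continuous uM := by
  rw [mat_closedEmbedding.isInducing.continuous_iff]
  refine continuous_matrix fun i j => ?_
  simp only [Function.comp_apply, mat_uM]
  fin_cases i <;> fin_cases j <;> simp <;> fun_prop

lemma uP_zero : uP 0 = 1 := by
  apply mat_inj
  rw [mat_uP, mat_one]
  ext i j; fin_cases i <;> fin_cases j <;> simp

lemma uM_zero : uM 0 = 1 := by
  apply mat_inj
  rw [mat_uM, mat_one]
  ext i j; fin_cases i <;> fin_cases j <;> simp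

/-- the diagonal elements are products of unipotents -/
lemma aE_prod (x : ℝ) (hx : 0 < x) :
    aE (-(2 * Real.log x)) =
      (uP x * uM x⁻¹ * uP x) * (uP (-1) * uM (-1) * uP (-1)) := by
  have h1 : Real.cosh (2 * Real.log x) = (x^2 + (x^2)⁻¹)/2 := by
    rw [Real.cosh_eq, Real.exp_neg, two_mul, Real.exp_add, Real.exp_log hx]; ring
  have h2 : Real.sinh (2 * Real.log x) = (x^2 - (x^2)⁻¹)/2 := by
    rw [Real.sinh_eq, Real.exp_neg, two_mul, Real.exp_add, Real.exp_log hx]; ring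
  apply mat_inj
  simp only [mat_mul]
  rw [mat_aE, Real.cosh_neg, Real.sinh_neg, h1, h2]
  simp only [mat_uP, mat_uM]
  ext i j; fin_cases i <;> fin_cases j <;>
        simp [Matrix.mul_apply, Fin.sum_univ_three] <;> field_simp <;> ring

lemma form_ij (g : LG) (i j : Fin 3) :
    mat g 0 i * mat g 0 j + mat g 1 i * mat g 1 j - mat g 2 i * mat g 2 j =
      (!![1,0,0;0,1,0;0,0,-1] : Matrix (Fin 3) (Fin 3) ℝ) i j := by
  rw [← mat_form g]
  fin_cases i <;> fin_cases j <;> simp [Matrix.mul_apply, Fin.sum_univ_three] <;> ring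

lemma mat_inv (g : LG) :
    mat g⁻¹ = !![1,0,0;0,1,0;0,0,-1] * (mat g)ᵀ * !![1,0,0;0,1,0;0,0,-1] := by
  have h1 : mat g * mat g⁻¹ = 1 := by rw [← mat_mul, mul_inv_cancel, mat_one]
  have hJ : (!![1,0,0;0,1,0;0,0,-1] : Matrix (Fin 3) (Fin 3) ℝ) * !![1,0,0;0,1,0;0,0,-1] = 1 := by
    ext i j; fin_cases i <;> fin_cases j <;> simp [Matrix.mul_apply, Fin.sum_univ_three]
  have h2 := mat_form g
  set J := (!![1,0,0;0,1,0;0,0,-1] : Matrix (Fin 3) (Fin 3) ℝ)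
  have h3 : J * (mat g)ᵀ * J * mat g = 1 := by
    rw [Matrix.mul_assoc, Matrix.mul_assoc, ← Matrix.mul_assoc (mat g)ᵀ, h2, hJ]
  calc mat g⁻¹ = (J * (mat g)ᵀ * J * mat g) * mat g⁻¹ := by rw [h3, Matrix.one_mul]
    _ = _ := by rw [Matrix.mul_assoc, h1, Matrix.mul_one]

lemma mat_inv2 (g : LG) :
    mat g⁻¹ = !![mat g 0 0, mat g 1 0, -mat g 2 0; mat g 0 1, mat g 1 1, -mat g 2 1;
      -mat g 0 2, -mat g 1 2, mat g 2 2] := by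
  rw [mat_inv]
  ext i j
  fin_cases i <;> fin_cases j <;>
    simp [Matrix.vecMul, Matrix.mul_apply, dotProduct, Fin.sum_univ_three]

lemma row_ij (g : LG) (i j : Fin 3) :
    mat g i 0 * mat g j 0 + mat g i 1 * mat g j 1 - mat g i 2 * mat g j 2 =
      (!![1,0,0;0,1,0;0,0,-1] : Matrix (Fin 3) (Fin 3) ℝ) i j := by
  have h := form_ij g⁻¹ i j
  rw [mat_inv2] at h
  fin_cases i <;> fin_cases j <;>
    simp at h ⊢ <;> linarith

lemma aE_mem (S : Subgroup LG) (hP : ∀ t, uP t ∈ S) (hM : ∀ t, uM t ∈ S) (s : ℝ) : aE s ∈ S := by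
  have := aE_prod (Real.exp (-s/2)) (Real.exp_pos _)
  rw [Real.log_exp] at this
  have hs : -(2 * (-s/2)) = s := by ring
  rw [hs] at this
  rw [this]
  exact S.mul_mem (S.mul_mem (S.mul_mem (hP _) (hM _)) (hP _))
    (S.mul_mem (S.mul_mem (hP _) (hM _)) (hP _))

lemma stab_pos (g : LG) (h0 : mat g 0 0 = 1) (h1 : mat g 1 0 = 0) (h2 : mat g 2 0 = 0)
    (hpos : 0 < mat g 1 1 + mat g 2 1) : g = aE (Real.log (mat g 1 1 + mat g 2 1)) := by
  have f01 := form_ij g 0 1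
  have f02 := form_ij g 0 2
  have f11 := form_ij g 1 1
  have f12 := form_ij g 1 2
  have f22 := form_ij g 2 2
  have hd := mat_det g
  rw [Matrix.det_fin_three] at hd
  simp [h0, h1, h2] at f01 f02 f11 f12 f22 hd
  rw [f01] at f11 f12
  rw [f02] at f12 f22
  simp at f11 f12 f22 hd
  set c := mat g 1 1
  set d := mat g 1 2
  set e := mat g 2 1
  set f := mat g 2 2
  have hf : f = c := by linear_combination f * (-f11) + c * hd + e * f12
  have hde : d = e := by linear_combination d * (-f11) + c * f12 + e * hd
  have hinv : (c + e)⁻¹ = c - e := by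
    exact inv_eq_of_mul_eq_one_right (by linarith)
  apply mat_inj
  rw [mat_aE, Real.cosh_eq, Real.sinh_eq, Real.exp_neg, Real.exp_log hpos, hinv]
  ext i j
  fin_cases i <;> fin_cases j <;> simp [h0, h1, h2, f01, f02]
  · change c = _; linarith
  · change d = _; linarith
  · change e = _; linarith
  · change f = _; linarith

lemma stab_mem (S : Subgroup LG) (hP : ∀ t, uP t ∈ S) (hM : ∀ t, uM t ∈ S) (hw : wE ∈ S)
    (g : LG) (h0 : mat g 0 0 = 1) (h1 : mat g 1 0 = 0) (h2 : mat g 2 0 = 0) : g ∈ S := by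
  rcases lt_trichotomy 0 (mat g 1 1 + mat g 2 1) with h | h | h
  · rw [stab_pos g h0 h1 h2 h]; exact aE_mem S hP hM _
  · exfalso
    have f01 := form_ij g 0 1
    have f11 := form_ij g 1 1
    simp [h0, h1, h2] at f01 f11
    rw [f01] at f11
    have : (mat g 1 1 + mat g 2 1) * (mat g 1 1 - mat g 2 1) = 1 := by linarith
    rw [← h] at this
    simp at this
  · have h' : wE * g ∈ S := by
      have e0 : mat (wE * g) 0 0 = 1 := by
        rw [mat_mul, mat_wE]; simp [Matrix.mul_apply, Fin.sum_univ_three, h0]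
      have e1 : mat (wE * g) 1 0 = 0 := by
        rw [mat_mul, mat_wE]; simp [Matrix.mul_apply, Fin.sum_univ_three, h1]
      have e2 : mat (wE * g) 2 0 = 0 := by
        rw [mat_mul, mat_wE]; simp [Matrix.mul_apply, Fin.sum_univ_three, h2]
      have e3 : 0 < mat (wE * g) 1 1 + mat (wE * g) 2 1 := by
        rw [mat_mul, mat_wE]; simp [Matrix.mul_apply, Fin.sum_univ_three]; linarith
      rw [stab_pos _ e0 e1 e2 e3]; exact aE_mem S hP hM _
    exact (S.mul_mem_cancel_left hw).1 h'

lemma gen_p (S : Subgroup LG) (hP : ∀ t, uP t ∈ S) (hM : ∀ t, uM t ∈ S) (hw : wE ∈ S)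
    (g : LG) (hp : mat g 1 0 + mat g 2 0 ≠ 0) : g ∈ S := by
  set x := mat g 0 0
  set y := mat g 1 0
  set z := mat g 2 0
  have hf := form_ij g 0 0
  simp at hf
  change x * x + y * y - z * z = 1 at hf
  set t := (1 - x) / (y + z) with ht
  have ht' : t * (y + z) = 1 - x := by rw [ht, div_mul_cancel₀ _ hp]
  -- now y+t... compute
  have hmem : uM ((y + z)/2) * (uP t * g) ∈ S := by
    have a0 : mat (uP t * g) 0 0 = 1 := by
      rw [mat_mul, mat_uP]; simp [Matrix.mul_apply, Fin.sum_univ_three]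
      change x + t * y + t * z = 1; linarith
    have a1 : mat (uP t * g) 1 0 = (y + z)/2 := by
      rw [mat_mul, mat_uP]; simp [Matrix.mul_apply, Fin.sum_univ_three]
      change -(t * x) + (1 - t^2/2) * y + -(t^2/2 * z) = (y+z)/2
      have : (y + z) * (-(t * x) + (1 - t^2/2) * y + -(t^2/2 * z)) = (y + z) * ((y+z)/2) := by
        linear_combination (-x - (t * (y+z) + (1-x))/2) * ht' + hf/2
      exact mul_left_cancel₀ hp this
    have a2 : mat (uP t * g) 2 0 = (y + z)/2 := by
      rw [mat_mul, mat_uP]; simp [Matrix.mul_apply, Fin.sum_univ_three]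
      change (t * x) + (t^2/2) * y + (1 + t^2/2) * z = (y+z)/2
      have : (y + z) * ((t * x) + (t^2/2) * y + (1 + t^2/2) * z) = (y + z) * ((y+z)/2) := by
        linear_combination (x + (t * (y+z) + (1-x))/2) * ht' - hf/2
      exact mul_left_cancel₀ hp this
    apply stab_mem S hP hM hw <;> rw [mat_mul, mat_uM] <;>
      simp [Matrix.mul_apply, Fin.sum_univ_three, a0, a1, a2] <;> ring
  exact (S.mul_mem_cancel_left (hP t)).1 ((S.mul_mem_cancel_left (hM _)).1 hmem)

lemma gen_all (S : Subgroup LG) (hP : ∀ t, uP t ∈ S) (hM : ∀ t, uM t ∈ S) (hw : wE ∈ S) :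
    S = ⊤ := by
  rw [eq_top_iff]
  rintro g -
  by_cases hp : mat g 1 0 + mat g 2 0 ≠ 0
  · exact gen_p S hP hM hw g hp
  · push Not at hp
    have hf := form_ij g 0 0
    simp at hf
    by_cases h1 : mat (uM 1 * g) 1 0 + mat (uM 1 * g) 2 0 ≠ 0
    · exact (S.mul_mem_cancel_left (hM 1)).1 (gen_p S hP hM hw _ h1)
    · have h2 : mat (uM (-1) * g) 1 0 + mat (uM (-1) * g) 2 0 ≠ 0 := by
        intro h2
        apply h1
        intro h1
        rw [mat_mul, mat_uM] at h1 h2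
        simp [Matrix.mul_apply, Fin.sum_univ_three] at h1 h2
        have hx : mat g 0 0 = 0 := by linarith
        rw [hx] at hf
        nlinarith
      exact (S.mul_mem_cancel_left (hM (-1))).1 (gen_p S hP hM hw _ h2)

lemma mautner_gen (S : Subgroup LG) (hw : wE ∈ S)
      (h1 : ∀ u : LG, Tendsto (fun n : ℕ => (aE 1) ^ n * u * ((aE 1) ^ n)⁻¹) atTop (nhds 1) → u ∈ S)
      (h2 : ∀ u : LG, Tendsto (fun n : ℕ => ((aE 1) ^ n)⁻¹ * u * (aE 1) ^ n) atTop (nhds 1) → u ∈ S) :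
      S = ⊤ := by
  have hexp : ∀ t : ℝ, Tendsto (fun n : ℕ => t * Real.exp (-(n * 1 : ℝ))) atTop (nhds 0) := by
    intro t
    have := (Real.tendsto_exp_neg_atTop_nhds_zero.comp tendsto_natCast_atTop_atTop).const_mul t
    simpa using this
  refine gen_all S (fun t => h1 _ ?_) (fun t => h2 _ ?_) hw
  · have := (uP_cont.tendsto 0).comp (hexp t)
    rw [uP_zero] at this
    refine this.congr fun n => ?_
    rw [aE_pow, aE_inv]
    have := aE_uP (-(n * 1 : ℝ)) t
    rw [neg_neg] at this
    simp only [Function.comp]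
    rw [this]
  · have := (uM_cont.tendsto 0).comp (hexp t)
    rw [uM_zero] at this
    refine this.congr fun n => ?_
    rw [aE_pow, aE_inv]
    have := aE_uM ((n * 1 : ℝ)) t
    simp only [Function.comp]
    rw [this]

lemma mautner_gen' (S : Subgroup LG) (hw : wE ∈ S)
      (h1 : ∀ u : LG, Tendsto (fun n : ℕ => (aE (-1)) ^ n * u * ((aE (-1)) ^ n)⁻¹) atTop (nhds 1) → u ∈ S)
      (h2 : ∀ u : LG, Tendsto (fun n : ℕ => ((aE (-1)) ^ n)⁻¹ * u * (aE (-1)) ^ n) atTop (nhds 1) → u ∈ S) :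
      S = ⊤ := by
  have : aE (-1) = (aE 1)⁻¹ := (aE_inv 1).symm
  rw [this] at h1 h2
  refine mautner_gen S hw (fun u hu => h2 u ?_) (fun u hu => h1 u ?_)
  · simpa using hu
  · simpa using hu

instance rightInv (m : Measure LG) [m.IsHaarMeasure] : m.IsMulRightInvariant := by
  have hker : (Measure.modularCharacter (G := LG)).ker = ⊤ := by
    have hexp : Real.exp (Real.log 2) = 2 := Real.exp_log (by norm_num)
    apply gen_all
    · intro t
      rw [MonoidHom.mem_ker]
      have h := aE_uP (Real.log 2) t
      rw [hexp, mul_two, ← uP_add] at h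
      have h' := congrArg (Measure.modularCharacter (G := LG)) h
      rw [← aE_inv] at h'
      simp only [map_mul] at h'
      have hi : Measure.modularCharacter (G := LG) (aE (Real.log 2))⁻¹ *
        Measure.modularCharacter (G := LG) (aE (Real.log 2)) = 1 := by
          rw [← map_mul]; simp
      have hne : Measure.modularCharacter (G := LG) (uP t) ≠ 0 :=
        (Measure.modularCharacterFun_pos (uP t)).ne'
      rw [mul_right_comm, hi, one_mul] at h'
      exact (mul_right_cancel₀ hne (by rw [one_mul]; exact h')).symm
    · intro t
      rw [MonoidHom.mem_ker]
      have h := aE_uM (-(Real.log 2)) t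
      rw [neg_neg, hexp, mul_two, ← uM_add] at h
      have h' := congrArg (Measure.modularCharacter (G := LG)) h
      rw [← aE_inv] at h'
      simp only [map_mul] at h'
      have hi : Measure.modularCharacter (G := LG) (aE (Real.log 2)) *
        Measure.modularCharacter (G := LG) (aE (Real.log 2))⁻¹ = 1 := by
          rw [← map_mul]; simp
      have hne : Measure.modularCharacter (G := LG) (uM t) ≠ 0 :=
        (Measure.modularCharacterFun_pos (uM t)).ne'
      rw [mul_right_comm, hi, one_mul] at h'
      exact (mul_right_cancel₀ hne (by rw [one_mul]; exact h')).symm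
    · rw [MonoidHom.mem_ker]
      have h := congrArg (Measure.modularCharacter (G := LG)) wE_sq
      rw [map_mul, map_one, ← sq] at h
      exact (pow_eq_one_iff_of_nonneg (by positivity) two_ne_zero).1 h
  refine ⟨fun g => ?_⟩
  rw [Measure.map_right_mul_eq_modularCharacterFun_smul]
  have : g ∈ (Measure.modularCharacter (G := LG)).ker := by rw [hker]; trivial
  have h1 : Measure.modularCharacterFun g = 1 := this
  rw [h1, one_smul]

/-- First column of g, i.e. g e₁. -/
def fcol (g : LG) : Fin 3 → ℝ := fun i => mat g i 0

def sc (g : LG) : ℝ := Real.log |mat g 2 1 + mat g 2 2|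

lemma fcol_mul (g h : LG) : fcol (g * h) = mat g *ᵥ fcol h := by
  ext i
  simp [fcol, mat_mul, Matrix.mul_apply, Matrix.mulVec, dotProduct]

lemma fcol_cont : Continuous fcol := continuous_pi fun i => cont_entry i 0

lemma sc_meas : Measurable sc := by
  unfold sc
  have h : Continuous fun g : LG => |mat g 2 1 + mat g 2 2| :=
    ((cont_entry 2 1).add (cont_entry 2 2)).abs
  exact Real.measurable_log.comp h.measurable

lemma eta_prod (g : LG) : (mat g 2 1 + mat g 2 2) * (mat g 2 1 - mat g 2 2) = -(1 + mat g 2 0 ^ 2) := by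
  have := row_ij g 2 2
  simp at this
  linarith

lemma eta_ne (g : LG) : mat g 2 1 + mat g 2 2 ≠ 0 := by
  intro h
  have := eta_prod g
  rw [h] at this
  nlinarith [sq_nonneg (mat g 2 0)]

lemma sc_aE (g : LG) (r : ℝ) : sc (g * aE r) = sc g + r := by
  unfold sc
  have : mat (g * aE r) 2 1 + mat (g * aE r) 2 2 = (mat g 2 1 + mat g 2 2) * Real.exp r := by
    rw [mat_mul, mat_aE]
    simp [Matrix.mul_apply, Fin.sum_univ_three]
    rw [← Real.cosh_add_sinh]; ring
  rw [this, abs_mul, Real.log_mul (abs_ne_zero.2 (eta_ne g)) (by simp), Real.abs_exp, Real.log_exp]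

lemma sc_wE (g : LG) : sc (g * wE) = sc g := by
  unfold sc
  have : mat (g * wE) 2 1 + mat (g * wE) 2 2 = -(mat g 2 1 + mat g 2 2) := by
    rw [mat_mul, mat_wE]
    simp [Matrix.mul_apply, Fin.sum_univ_three]; ring
  rw [this, abs_neg]

lemma fcol_aE (g : LG) (r : ℝ) : fcol (g * aE r) = fcol g := by
  ext i
  rw [fcol, mat_mul, mat_aE]
  simp [Matrix.mul_apply, Fin.sum_univ_three, fcol]

lemma fcol_wE (g : LG) : fcol (g * wE) = fcol g := by
  ext i
  rw [fcol, mat_mul, mat_wE]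
  simp [Matrix.mul_apply, Fin.sum_univ_three, fcol]

lemma frob_sq (M : Matrix (Fin 3) (Fin 3) ℝ) : frobNorm M ^ 2 = ∑ i, ∑ j, M i j ^ 2 :=
  Real.sq_sqrt (Finset.sum_nonneg fun _ _ => Finset.sum_nonneg fun _ _ => sq_nonneg _)

lemma frob_nonneg (M : Matrix (Fin 3) (Fin 3) ℝ) : 0 ≤ frobNorm M := Real.sqrt_nonneg _

lemma frob_eta (g : LG) : frobNorm (mat g) ^ 2 = (mat g 0 0 ^ 2 + mat g 1 0 ^ 2 + mat g 2 0 ^ 2)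
    + (mat g 2 1 + mat g 2 2) ^ 2 + (mat g 2 1 - mat g 2 2) ^ 2 := by
  rw [frob_sq]
  have h1 := form_ij g 1 1
  have h2 := form_ij g 2 2
  simp at h1 h2
  simp [Fin.sum_univ_three]
  linarith

lemma exp_sc (g : LG) : Real.exp (sc g) = |mat g 2 1 + mat g 2 2| :=
  Real.exp_log (abs_pos.2 (eta_ne g))

lemma eta_minus (g : LG) : |mat g 2 1 - mat g 2 2| = (1 + mat g 2 0 ^ 2) * Real.exp (- sc g) := by
  have h := congrArg abs (eta_prod g)
  rw [abs_mul, abs_neg, abs_of_pos (show 0 < 1 + mat g 2 0 ^ 2 by positivity), ← exp_sc] at h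
  rw [← h, mul_comm, ← mul_assoc, ← Real.exp_add]; simp

lemma pos_of_sq_pos {x : ℝ} (h0 : 0 ≤ x) (h : 0 < x ^ 2) : 0 < x := by
  rcases h0.eq_or_lt with h1 | h1
  · rw [← h1] at h; simp at h
  · exact h1

lemma frob_pos (g : LG) : 0 < frobNorm (mat g) := by
  have h : 0 < frobNorm (mat g) ^ 2 := by
    rw [frob_eta]
    have := sq_pos_of_ne_zero (eta_ne g)
    nlinarith [sq_nonneg (mat g 0 0), sq_nonneg (mat g 1 0), sq_nonneg (mat g 2 0), sq_nonneg (mat g 2 1 - mat g 2 2)]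
  exact pos_of_sq_pos (frob_nonneg _) h

lemma sc_le (g : LG) : |sc g| ≤ Real.log (frobNorm (mat g)) := by
  rw [Real.le_log_iff_exp_le (frob_pos g)]
  have hs := frob_eta g
  rcases abs_cases (sc g) with ⟨h, -⟩ | ⟨h, -⟩ <;> rw [h]
  · rw [exp_sc]
    refine abs_le_of_sq_le_sq ?_ (frob_nonneg _)
    nlinarith [sq_nonneg (mat g 0 0), sq_nonneg (mat g 1 0), sq_nonneg (mat g 2 0), sq_nonneg (mat g 2 1 - mat g 2 2)]
  · have h1 : Real.exp (- sc g) ≤ |mat g 2 1 - mat g 2 2| := by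
      rw [eta_minus]
      nlinarith [Real.exp_pos (-sc g), mul_nonneg (sq_nonneg (mat g 2 0)) (Real.exp_pos (-sc g)).le]
    refine h1.trans ?_
    refine abs_le_of_sq_le_sq ?_ (frob_nonneg _)
    nlinarith [sq_nonneg (mat g 0 0), sq_nonneg (mat g 1 0), sq_nonneg (mat g 2 0), sq_nonneg (mat g 2 1 + mat g 2 2)]

def cst (R : ℝ) : ℝ := 3 * R ^ 2 + 1 + (1 + R ^ 2) ^ 2

lemma le_sc (g : LG) (R : ℝ) (hR : ∀ i, |fcol g i| ≤ R) :
    Real.log (frobNorm (mat g)) ≤ |sc g| + cst R := by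
  have hs := frob_eta g
  have hb : ∀ i, mat g i 0 ^ 2 ≤ R ^ 2 := fun i => by
    have := hR i
    exact sq_le_sq' (abs_le.1 this).1 (abs_le.1 this).2
  have hc : 1 ≤ cst R := by unfold cst; nlinarith [sq_nonneg R, sq_nonneg (1 + R^2)]
  have h1 : (mat g 2 1 + mat g 2 2) ^ 2 ≤ Real.exp |sc g| ^ 2 := by
    rw [← sq_abs (mat g 2 1 + mat g 2 2), ← exp_sc]
    have := Real.exp_le_exp.2 (le_abs_self (sc g))
    gcongr
  have h2 : (mat g 2 1 - mat g 2 2) ^ 2 ≤ (1 + R^2)^2 * Real.exp |sc g| ^ 2 := by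
    rw [← sq_abs (mat g 2 1 - mat g 2 2), eta_minus, mul_pow]
    have := Real.exp_le_exp.2 (neg_le_abs (sc g))
    have := hb 2
    gcongr
  have h3 : 1 ≤ Real.exp |sc g| ^ 2 := one_le_pow₀ (Real.one_le_exp (abs_nonneg _))
  have h4 : frobNorm (mat g) ^ 2 ≤ cst R * Real.exp |sc g| ^ 2 := by
    rw [hs]; unfold cst
    nlinarith [hb 0, hb 1, hb 2, mul_le_mul_of_nonneg_left h3 (sq_nonneg R)]
  have h5 : Real.log (frobNorm (mat g) ^ 2) ≤ Real.log (cst R * Real.exp |sc g| ^ 2) :=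
    Real.log_le_log (pow_pos (frob_pos g) 2) h4
  rw [Real.log_mul (by positivity) (by positivity), Real.log_pow, Real.log_pow, Real.log_exp] at h5
  have h6 := Real.log_le_sub_one_of_pos (show 0 < cst R by positivity)
  push_cast at h5
  linarith

lemma frob_inv (g : LG) : frobNorm (mat g⁻¹) = frobNorm (mat g) := by
  rw [mat_inv2]
  unfold frobNorm
  congr 1
  simp [Fin.sum_univ_three]
  ring

lemma frob_mul (g h : LG) : frobNorm (mat (g * h)) ≤ frobNorm (mat g) * frobNorm (mat h) := by
  refine (le_abs_self _).trans (abs_le_of_sq_le_sq ?_ (mul_nonneg (frob_nonneg _) (frob_nonneg _)))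
  rw [mul_pow, frob_sq, frob_sq, frob_sq, mat_mul, Finset.sum_mul]
  refine Finset.sum_le_sum fun i _ => ?_
  rw [Finset.sum_comm, Finset.mul_sum]
  refine Finset.sum_le_sum fun j _ => ?_
  rw [Matrix.mul_apply]
  exact Finset.sum_mul_sq_le_sq_mul_sq _ _ _

lemma log_frob_mul (g h : LG) : Real.log (frobNorm (mat (g * h))) ≤
    Real.log (frobNorm (mat g)) + Real.log (frobNorm (mat h)) := by
  rw [← Real.log_mul (frob_pos g).ne' (frob_pos h).ne']
  exact Real.log_le_log (frob_pos _) (frob_mul g h)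

lemma fcol_dS (g : LG) : fcol g ∈ deSitter 2 := by
  have := form_ij g 0 0
  simp at this
  simp [deSitter, Fin.sum_univ_three, fcol]
  linarith

/-- comparison of the norm of γ with the flow time. -/
lemma compare (y γ : LG) (R : ℝ) (hR : ∀ i, |fcol (γ⁻¹ * y⁻¹) i| ≤ R) :
    |Real.log (frobNorm (mat γ)) - (|sc (γ⁻¹ * y⁻¹)|)| ≤ Real.log (frobNorm (mat y)) + cst R := by
  have h1 := sc_le (γ⁻¹ * y⁻¹)
  have h2 := le_sc _ R hR
  have h3 := log_frob_mul γ⁻¹ y⁻¹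
  have h4 := log_frob_mul (γ⁻¹ * y⁻¹) y
  rw [inv_mul_cancel_right] at h4
  rw [frob_inv] at h3 h4
  rw [frob_inv] at h3
  have hc : 0 ≤ cst R := by unfold cst; positivity
  rw [abs_le]; constructor <;> linarith

def fdS : Set LG := {g | sc g⁻¹ ∈ Set.Ico (0 : ℝ) 1}

def piL (g : LG) : Fin 3 → ℝ := fcol g⁻¹

lemma piL_cont : Continuous piL := fcol_cont.comp continuous_inv
lemma piL_meas : Measurable piL := piL_cont.measurable

lemma fdS_meas : MeasurableSet fdS :=
  (sc_meas.comp measurable_inv) measurableSet_Ico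

lemma sc_floor (n : ℤ) (s : ℝ) : s - n ∈ Set.Ico (0 : ℝ) 1 ↔ ⌊s⌋ = n := by
  rw [Int.floor_eq_iff, Set.mem_Ico]
  constructor <;> rintro ⟨h1, h2⟩ <;> constructor <;> linarith

lemma fdS_dom (m : Measure LG) (g' : LG) :
    IsFundamentalDomain (Subgroup.zpowers (aE 1)) {g : LG | g * g' ∈ fdS} m := by
  have key : ∀ (n : ℤ) (x : LG), (aE 1) ^ n * x * g' ∈ fdS ↔ ⌊sc (x * g')⁻¹⌋ = n := by
    intro n x
    rw [← sc_floor]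
    have : ((aE 1) ^ n * x * g')⁻¹ = (x * g')⁻¹ * aE (-n) := by
      rw [aE_zpow, mul_assoc, _root_.mul_inv_rev, aE_inv]; simp
    rw [fdS, Set.mem_ofPred_eq, this, sc_aE, ← sub_eq_add_neg]
  refine IsFundamentalDomain.mk' ((measurable_mul_const g') fdS_meas).nullMeasurableSet ?_
  intro x
  refine ⟨⟨(aE 1) ^ ⌊sc (x * g')⁻¹⌋, ⟨_, rfl⟩⟩, (key _ x).2 rfl, ?_⟩
  rintro ⟨_, ⟨n, rfl⟩⟩ h
  have h' := (key n x).1 h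
  apply Subtype.ext
  rw [← h']

def nu0 (m : Measure LG) : Measure (Fin 3 → ℝ) := Measure.map piL (m.restrict fdS)

lemma nu0_apply (m : Measure LG) {B : Set (Fin 3 → ℝ)} (hB : MeasurableSet B) :
    nu0 m B = m (piL ⁻¹' B ∩ fdS) := by
  rw [nu0, Measure.map_apply piL_meas hB, Measure.restrict_apply (piL_meas hB)]

lemma dS_closed : IsClosed (deSitter 2) := by
  have : deSitter 2 = {x : Fin 3 → ℝ | x 0 ^ 2 + x 1 ^ 2 - x 2 ^ 2 = 1} := by
    ext x
    simp [deSitter, Fin.sum_univ_three, sub_eq_add_neg]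
  rw [this]
  exact isClosed_eq (by fun_prop) continuous_const

lemma nu0_dS (m : Measure LG) : nu0 m (deSitter 2)ᶜ = 0 := by
  rw [nu0_apply m dS_closed.measurableSet.compl]
  have : piL ⁻¹' (deSitter 2)ᶜ = ∅ := by
    ext g; simp [piL, fcol_dS]
  rw [this]; simp

lemma nu0_ne (m : Measure LG) [m.IsHaarMeasure] : nu0 m ≠ 0 := by
  intro h
  have h1 : nu0 m Set.univ = 0 := by rw [h]; simp
  rw [nu0_apply m MeasurableSet.univ] at h1
  have h2 := (fdS_dom m 1).measure_ne_zero (NeZero.ne m)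
  simp at h1 h2
  exact h2 h1

lemma mulVec_meas (g : LG) : Measurable fun x : Fin 3 → ℝ => mat g *ᵥ x :=
  (Continuous.matrix_mulVec continuous_const continuous_id).measurable

lemma nu0_inv (m : Measure LG) [m.IsHaarMeasure] (g' : LG) :
    Measure.map (fun x => mat g' *ᵥ x) (nu0 m) = nu0 m := by
  ext B hB
  rw [Measure.map_apply (mulVec_meas g') hB, nu0_apply m (mulVec_meas g' hB), nu0_apply m hB]
  rw [← measure_preimage_mul_right m g']
  have e1 : (fun h => h * g') ⁻¹' (piL ⁻¹' ((fun x => mat g' *ᵥ x) ⁻¹' B) ∩ fdS)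
      = piL ⁻¹' B ∩ {g | g * g' ∈ fdS} := by
    ext h
    simp [piL, ← fcol_mul]
  have e2 : piL ⁻¹' B ∩ fdS = piL ⁻¹' B ∩ {g | g * 1 ∈ fdS} := by simp
  rw [e1, e2]
  refine (fdS_dom m g').measure_set_eq (fdS_dom m 1) (piL_meas hB) ?_
  rintro ⟨_, ⟨n, rfl⟩⟩
  ext x
  simp only [Set.mem_preimage]
  have : piL ((aE 1) ^ n * x) = piL x := by
    rw [piL, _root_.mul_inv_rev, aE_zpow, aE_inv, fcol_aE]; rfl
  show piL ((aE 1) ^ n * x) ∈ B ↔ _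
  rw [this]

instance nu0_fin (m : Measure LG) [m.IsHaarMeasure] : IsFiniteMeasureOnCompacts (nu0 m) := by
  refine ⟨fun K hK => ?_⟩
  rw [nu0_apply m hK.measurableSet]
  obtain ⟨R, hR⟩ := hK.isBounded.exists_norm_le
  refine lt_of_le_of_lt (measure_mono ?_) (compact_frob (Real.exp (1 + cst R))).measure_lt_top
  rintro g ⟨h1, h2⟩
  have h3 := le_sc g⁻¹ R fun i => (norm_le_pi_norm (fcol g⁻¹) i).trans (hR _ h1)
  rw [frob_inv, Real.log_le_iff_le_exp (frob_pos g), abs_of_nonneg h2.1] at h3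
  exact h3.trans (Real.exp_le_exp.2 (by linarith [h2.2]))

lemma sandwich_nat (p s : ℕ → ℝ) (k : ℕ) (z L : ℝ)
    (hp : Tendsto (fun N : ℕ => p N / N) atTop (nhds L))
    (h1 : ∀ N, s N ≤ p (N + k)) (h2 : ∀ N, p N ≤ s (N + k) + z) :
    Tendsto (fun N : ℕ => s N / N) atTop (nhds L) := by
  have hr : ∀ j l : ℕ, Tendsto (fun N : ℕ => ((N + j : ℕ) : ℝ) / ((N + l : ℕ) : ℝ)) atTop (nhds 1) := by
    intro j l
    have h0 : Tendsto (fun N : ℕ => ((N + l : ℕ) : ℝ)) atTop atTop :=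
      tendsto_natCast_atTop_atTop.comp (tendsto_add_atTop_nat l)
    have h1 : Tendsto (fun N : ℕ => 1 + ((j : ℝ) - l) / ((N + l : ℕ) : ℝ)) atTop (nhds (1 + 0)) :=
      tendsto_const_nhds.add (h0.const_div_atTop _)
    rw [add_zero] at h1
    refine h1.congr' ?_
    filter_upwards [eventually_gt_atTop 0] with N hN
    have : ((N + l : ℕ) : ℝ) ≠ 0 := by positivity
    field_simp
    push_cast; ring
  have hz : Tendsto (fun N : ℕ => z / ((N + k : ℕ) : ℝ)) atTop (nhds 0) :=
    (tendsto_natCast_atTop_atTop.comp (tendsto_add_atTop_nat k)).const_div_atTop _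
  rw [← tendsto_add_atTop_iff_nat k]
  have hlow := (hp.mul (hr 0 k)).sub hz
  have hupp := (hp.comp (tendsto_add_atTop_nat (k + k))).mul (hr (k+k) k)
  rw [mul_one, sub_zero] at hlow
  rw [mul_one] at hupp
  refine tendsto_of_tendsto_of_tendsto_of_le_of_le' hlow hupp ?_ ?_
  · filter_upwards [eventually_gt_atTop 0] with N hN
    have h0 : (N : ℝ) ≠ 0 := by positivity
    have h3 : 0 < ((N + k : ℕ) : ℝ) := by positivity
    rw [add_zero, div_mul_div_cancel₀ h0, ← sub_div]
    have := h2 N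
    gcongr
    linarith
  · filter_upwards [eventually_gt_atTop 0] with N hN
    have h0 : ((N + (k + k) : ℕ) : ℝ) ≠ 0 := by positivity
    simp only [Function.comp]
    rw [div_mul_div_cancel₀ h0]
    have := h1 (N + k)
    rw [add_assoc] at this
    gcongr

lemma nat_to_real (s : ℝ → ℝ) (hs : Monotone s) (L : ℝ)
    (h : Tendsto (fun N : ℕ => s N / N) atTop (nhds L)) :
    Tendsto (fun t : ℝ => s t / t) atTop (nhds L) := by
  have hfl := tendsto_nat_floor_div_atTop (R := ℝ)
  have h1 := (h.comp (tendsto_nat_floor_atTop (α := ℝ))).mul hfl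
  have h2' : Tendsto (fun t : ℝ => ((⌊t⌋₊ + 1 : ℕ) : ℝ) / t) atTop (nhds 1) := by
    have := hfl.add (tendsto_inv_atTop_zero (𝕜 := ℝ))
    rw [add_zero] at this
    refine this.congr fun t => ?_
    push_cast; rw [add_div, one_div]
  have h2 := ((h.comp (tendsto_add_atTop_nat 1)).comp (tendsto_nat_floor_atTop (α := ℝ))).mul h2'
  rw [mul_one] at h1 h2
  refine tendsto_of_tendsto_of_tendsto_of_le_of_le' h1 h2 ?_ ?_
  · filter_upwards [eventually_ge_atTop 1] with t ht
    have : (⌊t⌋₊ : ℝ) ≠ 0 := by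
      have := (Nat.floor_pos).2 ht
      positivity
    simp only [Function.comp]
    rw [div_mul_div_cancel₀ this]
    have := hs (Nat.floor_le (show 0 ≤ t by linarith))
    gcongr
  · filter_upwards [eventually_ge_atTop 1] with t ht
    have : ((⌊t⌋₊ + 1 : ℕ) : ℝ) ≠ 0 := by positivity
    simp only [Function.comp]
    rw [div_mul_div_cancel₀ this]
    have := hs (show t ≤ ((⌊t⌋₊ + 1 : ℕ) : ℝ) by push_cast; exact (Nat.lt_floor_add_one t).le)
    gcongr

def SS (Γ : Subgroup LG) (ψ : (Fin 3 → ℝ) → ℝ≥0∞) (t : ℝ) (x : Fin 3 → ℝ) : ℝ≥0∞ :=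
  ∑' γ : Γ, open Classical in
    if Real.log (frobNorm (mat (γ : LG))) ≤ t then ψ (mat ((γ : LG)⁻¹) *ᵥ x) else 0

def fF (ψ : (Fin 3 → ℝ) → ℝ≥0∞) : LG → ℝ≥0∞ := fdS.indicator fun g => ψ (piL g)

lemma fF_aE (ψ : (Fin 3 → ℝ) → ℝ≥0∞) (z : ℤ) (g : LG) :
    fF ψ (aE z * g) = if ⌊sc g⁻¹⌋ = z then ψ (fcol g⁻¹) else 0 := by
  classical
  have h1 : (aE z * g)⁻¹ = g⁻¹ * aE (-z) := by rw [_root_.mul_inv_rev, aE_inv]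
  have h2 : aE z * g ∈ fdS ↔ ⌊sc g⁻¹⌋ = z := by
    rw [← sc_floor, fdS, Set.mem_ofPred_eq, h1, sc_aE, ← sub_eq_add_neg]
  rw [fF, Set.indicator_apply]
  simp only [h2]
  rw [piL, h1, fcol_aE]

lemma sum_ind (j : ℤ) (c : ℝ≥0∞) (N : ℕ) :
    (∑ n ∈ Finset.range N, if j = (n : ℤ) then c else 0) = if 0 ≤ j ∧ j < N then c else 0 := by
  by_cases h : 0 ≤ j
  · lift j to ℕ using h
    simp
  · rw [if_neg (by tauto)]
    refine Finset.sum_eq_zero fun n _ => if_neg (by omega)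

lemma orbit_avg (Γ : Subgroup LG) (ψ : (Fin 3 → ℝ) → ℝ≥0∞) (R : ℝ)
    (hψ : ∀ x, ψ x ≠ 0 → ∀ i, |x i| ≤ R) (y : LG) (I : ℝ≥0∞) (hI : I ≠ ⊤)
    (hP : Tendsto (fun N : ℕ => (∑ n ∈ Finset.range N, ∑' γ : Γ, fF ψ ((aE 1) ^ n * y * γ)) / N)
      atTop (nhds I))
    (hQ : Tendsto (fun N : ℕ => (∑ n ∈ Finset.range N, ∑' γ : Γ, fF ψ ((aE (-1)) ^ n * y * γ)) / N)
      atTop (nhds I)) :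
    Tendsto (fun N : ℕ => SS Γ ψ N (piL y) / N) atTop (nhds (I + I)) := by
  classical
  set h : Γ → LG := fun γ => (γ : LG)⁻¹ * y⁻¹ with hh
  set j : Γ → ℤ := fun γ => ⌊sc (h γ)⌋ with hj
  set c : Γ → ℝ≥0∞ := fun γ => ψ (fcol (h γ)) with hc
  have hinv : ∀ γ : Γ, (y * (γ : LG))⁻¹ = h γ := fun γ => by rw [_root_.mul_inv_rev]
  set P : ℕ → ℝ≥0∞ := fun N => ∑' γ, if 0 ≤ j γ ∧ j γ < N then c γ else 0 with hPdef
  set Q : ℕ → ℝ≥0∞ := fun N => ∑' γ, if 0 ≤ -j γ ∧ -j γ < N then c γ else 0 with hQdef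
  have eP : ∀ N, ∑ n ∈ Finset.range N, ∑' γ : Γ, fF ψ ((aE 1) ^ n * y * γ) = P N := by
    intro N
    rw [← Summable.tsum_finsetSum (fun _ _ => ENNReal.summable)]
    refine tsum_congr fun γ => ?_
    rw [← sum_ind]
    refine Finset.sum_congr rfl fun n _ => ?_
    have := fF_aE ψ n (y * γ)
    rw [hinv] at this
    rw [← this, aE_pow, mul_one, mul_assoc]; simp
  have eQ : ∀ N, ∑ n ∈ Finset.range N, ∑' γ : Γ, fF ψ ((aE (-1)) ^ n * y * γ) = Q N := by
    intro N
    rw [← Summable.tsum_finsetSum (fun _ _ => ENNReal.summable)]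
    refine tsum_congr fun γ => ?_
    rw [← sum_ind]
    refine Finset.sum_congr rfl fun n _ => ?_
    have := fF_aE ψ (-n) (y * γ)
    rw [hinv] at this
    rw [aE_pow, mul_neg, mul_one, mul_assoc]
    simp only [neg_eq_iff_eq_neg]
    rw [← this]; simp
  simp only [eP] at hP
  simp only [eQ] at hQ
  have hPQ : Tendsto (fun N : ℕ => (P N + Q N) / N) atTop (nhds (I + I)) := by
    simpa only [ENNReal.add_div] using hP.add hQ
  have hII : I + I ≠ ⊤ := ENNReal.add_ne_top.2 ⟨hI, hI⟩
  have mono : Monotone fun N => P N + Q N := by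
    intro a b hab
    refine add_le_add (ENNReal.tsum_le_tsum fun γ => ?_) (ENNReal.tsum_le_tsum fun γ => ?_)
    · split_ifs with h1 h2
      · exact le_rfl
      · exact absurd ⟨h1.1, by omega⟩ h2
      · exact bot_le
      · exact le_rfl
    · split_ifs with h1 h2
      · exact le_rfl
      · exact absurd ⟨h1.1, by omega⟩ h2
      · exact bot_le
      · exact le_rfl
  have fin : ∀ N, P N + Q N ≠ ⊤ := by
    intro N
    have h1 := hPQ.eventually (gt_mem_nhds hII.lt_top)
    obtain ⟨M, hM, hN⟩ := (h1.and (eventually_ge_atTop N)).exists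
    intro htop
    have h2 : P M + Q M = ⊤ := top_le_iff.1 (htop ▸ mono hN)
    rw [h2, ENNReal.top_div_of_ne_top (by simp)] at hM
    exact lt_irrefl _ hM
  set C := Real.log (frobNorm (mat y)) + cst R with hC
  obtain ⟨k, hk⟩ := exists_nat_gt (C + 2)
  have hcmp : ∀ γ : Γ, c γ ≠ 0 →
      |Real.log (frobNorm (mat (γ : LG))) - (|sc (h γ)|)| ≤ C := fun γ hγ =>
    compare y γ R (hψ _ hγ)
  have hSS : ∀ t, SS Γ ψ t (piL y) = ∑' γ : Γ, if Real.log (frobNorm (mat (γ : LG))) ≤ t then c γ else 0 := by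
    intro t
    refine tsum_congr fun γ => ?_
    rw [hc, hh, piL]
    simp only [fcol_mul]
  have ub : ∀ N : ℕ, SS Γ ψ N (piL y) ≤ P (N + k) + Q (N + k) := by
    intro N
    rw [hSS, hPdef, hQdef, ← ENNReal.tsum_add]
    refine ENNReal.tsum_le_tsum fun γ => ?_
    by_cases hγ : c γ = 0
    · simp [hγ]
    split_ifs with h1 h2 h3 h3 <;> try simp
    exfalso
    have h4 := abs_le.1 (hcmp γ hγ)
    have h5 : |sc (h γ)| ≤ N + C := by linarith
    have h6 := abs_le.1 h5
    have h7 : (j γ : ℝ) ≤ sc (h γ) := Int.floor_le _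
    have h8 : sc (h γ) < j γ + 1 := Int.lt_floor_add_one _
    have h9 : (j γ : ℝ) < ((N + k : ℕ) : ℤ) := by push_cast; linarith
    have h10 : -(j γ : ℝ) < ((N + k : ℕ) : ℤ) := by push_cast; linarith
    have h9' : j γ < ((N + k : ℕ) : ℤ) := by exact_mod_cast h9
    have h10' : -j γ < ((N + k : ℕ) : ℤ) := by exact_mod_cast h10
    rcases le_total 0 (j γ) with h | h
    · exact h2 ⟨h, h9'⟩
    · exact h3 ⟨by omega, h10'⟩
  have lb : ∀ N : ℕ, P N + Q N ≤ SS Γ ψ (N + k : ℕ) (piL y) + P 1 := by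
    intro N
    rw [hSS, hPdef, hQdef, ← ENNReal.tsum_add, ← ENNReal.tsum_add]
    refine ENNReal.tsum_le_tsum fun γ => ?_
    by_cases hγ : c γ = 0
    · simp [hγ]
    by_cases hab : -(N : ℤ) < j γ ∧ j γ < N
    · have h4 := abs_le.1 (hcmp γ hγ)
      have h7 : (j γ : ℝ) ≤ sc (h γ) := Int.floor_le _
      have h8 : sc (h γ) < j γ + 1 := Int.lt_floor_add_one _
      have h9 : (j γ : ℝ) < (N : ℤ) := by exact_mod_cast hab.2
      have h10 : ((-(N : ℤ) : ℤ) : ℝ) < j γ := by exact_mod_cast hab.1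
      push_cast at h9 h10
      have h5 : |sc (h γ)| ≤ N + 1 := abs_le.2 ⟨by linarith, by linarith⟩
      rw [if_pos (show Real.log (frobNorm (mat (γ : LG))) ≤ ((N + k : ℕ) : ℝ) by push_cast; linarith)]
      by_cases h0 : j γ = 0
      · refine add_le_add ?_ ?_
        · split_ifs <;> simp
        · rw [if_pos (show 0 ≤ j γ ∧ j γ < ((1 : ℕ) : ℤ) by omega)]
          split_ifs <;> simp
      · refine le_trans ?_ le_self_add
        rcases lt_or_gt_of_ne h0 with h | h
        · rw [if_neg (by omega), zero_add]; split_ifs <;> simp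
        · rw [if_neg (show ¬ (0 ≤ -j γ ∧ -j γ < N) by omega), add_zero]; split_ifs <;> simp
    · rw [if_neg (by omega), if_neg (by omega)]; simp
  have finS : ∀ N : ℕ, SS Γ ψ N (piL y) ≠ ⊤ := fun N => ne_top_of_le_ne_top (fin _) (ub N)
  have finP : P 1 ≠ ⊤ := ne_top_of_le_ne_top (fin 1) le_self_add
  have hreal := sandwich_nat (fun N => (P N + Q N).toReal) (fun N => (SS Γ ψ N (piL y)).toReal) k
    (P 1).toReal (I + I).toReal
    (by
      have := (ENNReal.tendsto_toReal hII).comp hPQ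
      simpa [Function.comp_def, ENNReal.toReal_div] using this)
    (fun N => ENNReal.toReal_mono (fin _) (ub N))
    (fun N => by
      rw [← ENNReal.toReal_add (finS _) finP]
      exact ENNReal.toReal_mono (ENNReal.add_ne_top.2 ⟨finS _, finP⟩) (lb N))
  have := ENNReal.tendsto_ofReal hreal
  rw [ENNReal.ofReal_toReal hII] at this
  refine this.congr' ?_
  filter_upwards [eventually_gt_atTop 0] with N hN
  rw [ENNReal.ofReal_div_of_pos (by positivity), ENNReal.ofReal_toReal (finS N), ENNReal.ofReal_natCast]

lemma dom_op (Γ : Subgroup LG) (m : Measure LG) (D : Set LG) (hD : MeasurableSet D)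
    (hfund : ∀ g : LG, ∃! γ : LG, γ ∈ Γ ∧ g * γ ∈ D) : IsFundamentalDomain Γ.op D m := by
  refine IsFundamentalDomain.mk' hD.nullMeasurableSet fun x => ?_
  obtain ⟨γ, ⟨h1, h2⟩, h3⟩ := hfund x
  refine ⟨⟨MulOpposite.op γ, h1⟩, h2, ?_⟩
  rintro ⟨δ, hδ⟩ hx
  apply Subtype.ext
  have := h3 δ.unop ⟨hδ, hx⟩
  exact MulOpposite.unop_injective this

lemma SS_meas (Γ : Subgroup LG) [DiscreteTopology Γ] (ψ : (Fin 3 → ℝ) → ℝ≥0∞) (hψ : Measurable ψ)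
    (t : ℝ) : Measurable (SS Γ ψ t) := by
  have := count_disc Γ
  unfold SS
  refine Measurable.tsum fun γ => ?_
  split_ifs
  · exact hψ.comp (mulVec_meas _)
  · exact measurable_const

lemma lint_nu0 (m : Measure LG) (ψ : (Fin 3 → ℝ) → ℝ≥0∞) (hψ : Measurable ψ) :
    ∫⁻ g, fF ψ g ∂m = ∫⁻ x, ψ x ∂(nu0 m) := by
  rw [nu0, lintegral_map hψ piL_meas, fF, lintegral_indicator fdS_meas]

lemma fF_meas (ψ : (Fin 3 → ℝ) → ℝ≥0∞) (hψ : Measurable ψ) : Measurable (fF ψ) :=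
  (hψ.comp piL_meas).indicator fdS_meas

lemma fF_wE (ψ : (Fin 3 → ℝ) → ℝ≥0∞) (g : LG) : fF ψ (wE * g) = fF ψ g := by
  classical
  have hw : wE⁻¹ = wE := inv_eq_of_mul_eq_one_right wE_sq
  have h1 : (wE * g)⁻¹ = g⁻¹ * wE := by rw [_root_.mul_inv_rev, hw]
  have h2 : wE * g ∈ fdS ↔ g ∈ fdS := by
    rw [fdS, Set.mem_ofPred_eq, Set.mem_ofPred_eq, h1, sc_wE]
  rw [fF, Set.indicator_apply, Set.indicator_apply]
  simp only [h2]
  rw [piL, piL, h1, fcol_wE]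

theorem key_nat (Γ : Subgroup LG) [DiscreteTopology Γ] (m : Measure LG) [m.IsHaarMeasure]
    (D : Set LG) (hDom : IsFundamentalDomain Γ.op D m) (hfin : m D < ⊤) (hD0 : m D ≠ 0)
    (ψ : (Fin 3 → ℝ) → ℝ≥0∞) (hψm : Measurable ψ) (R : ℝ)
    (hψ : ∀ x, ψ x ≠ 0 → ∀ i, |x i| ≤ R) (hintegr : ∫⁻ x, ψ x ∂(nu0 m) ≠ ⊤) :
    ∀ᵐ x ∂(nu0 m), Tendsto (fun N : ℕ => SS Γ ψ N x / N) atTop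
      (nhds ((2 / m D) * ∫⁻ x, ψ x ∂(nu0 m))) := by
  have h1 := abstract_average Γ m hDom hfin (aE 1) wE (aE_wE 1)
    (fun S _ hw h1 h2 => mautner_gen S hw h1 h2) (fF ψ) (fF_meas ψ hψm)
    (by rw [lint_nu0 m ψ hψm]; exact hintegr) (fF_wE ψ)
  have h2 := abstract_average Γ m hDom hfin (aE (-1)) wE (aE_wE (-1))
    (fun S _ hw h1 h2 => mautner_gen' S hw h1 h2) (fF ψ) (fF_meas ψ hψm)
    (by rw [lint_nu0 m ψ hψm]; exact hintegr) (fF_wE ψ)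
  rw [lint_nu0 m ψ hψm] at h1 h2
  set J := ∫⁻ x, ψ x ∂(nu0 m)
  have hJ : (2 / m D) * J = J / m D + J / m D := by
    rw [← two_mul, div_eq_mul_inv, div_eq_mul_inv]; ring
  rw [hJ]
  have hms : MeasurableSet {x | Tendsto (fun N : ℕ => SS Γ ψ N x / N) atTop (nhds (J / m D + J / m D))} :=
    measurableSet_tendsto _ fun N => (SS_meas Γ ψ hψm N).div_const _
  rw [nu0, ae_map_iff piL_meas.aemeasurable hms]
  apply ae_restrict_of_ae
  filter_upwards [h1, h2] with y hy1 hy2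
  exact orbit_avg Γ ψ R hψ y _ (ENNReal.div_ne_top hintegr hD0) hy1 hy2

lemma fin_ball (Γ : Subgroup LG) [DiscreteTopology Γ] (t : ℝ) :
    {γ : Γ | Real.log (frobNorm (mat (γ : LG))) ≤ t}.Finite := by
  have hcl : IsClosed (Γ : Set LG) := Subgroup.isClosed_of_discrete
  have hK : IsCompact {g : Γ | frobNorm (mat (g : LG)) ≤ Real.exp t} :=
    hcl.isClosedEmbedding_subtypeVal.isCompact_preimage (compact_frob (Real.exp t))
  refine hK.finite_of_discrete.subset fun γ hγ => ?_
  exact (Real.log_le_iff_le_exp (frob_pos _)).1 hγ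

lemma SS_eq (Γ : Subgroup LG) (ψ : (Fin 3 → ℝ) → ℝ≥0∞) (t : ℝ) (x : Fin 3 → ℝ) :
    SS Γ ψ t x = ∑' γ : {γ : Γ // Real.log (frobNorm (mat (γ : LG))) ≤ t},
      ψ (mat ((γ : Γ) : LG)⁻¹ *ᵥ x) := by
  have := tsum_subtype {γ : Γ | Real.log (frobNorm (mat (γ : LG))) ≤ t}
    (fun γ : Γ => ψ (mat (γ : LG)⁻¹ *ᵥ x))
  refine Eq.trans ?_ this.symm
  refine tsum_congr fun γ => ?_
  classical
  rw [Set.indicator_apply]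
  simp only [Set.mem_ofPred_eq]

lemma SS_ne_top (Γ : Subgroup LG) [DiscreteTopology Γ] (ψ : (Fin 3 → ℝ) → ℝ≥0∞)
    (hψ : ∀ x, ψ x ≠ ⊤) (t : ℝ) (x : Fin 3 → ℝ) : SS Γ ψ t x ≠ ⊤ := by
  have : Fintype {γ : Γ // Real.log (frobNorm (mat (γ : LG))) ≤ t} := (fin_ball Γ t).fintype
  rw [SS_eq, tsum_fintype]
  exact ENNReal.sum_ne_top.2 fun _ _ => hψ _

lemma SS_toReal (Γ : Subgroup LG) [DiscreteTopology Γ] (ψ : (Fin 3 → ℝ) → ℝ≥0∞)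
    (hψ : ∀ x, ψ x ≠ ⊤) (t : ℝ) (x : Fin 3 → ℝ) : (SS Γ ψ t x).toReal =
      ∑' γ : {γ : Γ // Real.log (frobNorm (mat (γ : LG))) ≤ t},
      (ψ (mat ((γ : Γ) : LG)⁻¹ *ᵥ x)).toReal := by
  rw [SS_eq, ENNReal.tsum_toReal_eq fun _ => hψ _]

theorem key_real (Γ : Subgroup LG) [DiscreteTopology Γ] (m : Measure LG) [m.IsHaarMeasure]
    (D : Set LG) (hDom : IsFundamentalDomain Γ.op D m) (hfin : m D < ⊤) (hD0 : m D ≠ 0)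
    (ψ : (Fin 3 → ℝ) → ℝ≥0∞) (hψm : Measurable ψ) (hψt : ∀ x, ψ x ≠ ⊤) (R : ℝ)
    (hψ : ∀ x, ψ x ≠ 0 → ∀ i, |x i| ≤ R) (hintegr : ∫⁻ x, ψ x ∂(nu0 m) ≠ ⊤) :
    ∀ᵐ x ∂(nu0 m), Tendsto (fun t : ℝ => (SS Γ ψ t x).toReal / t) atTop
      (nhds ((2 / m D) * ∫⁻ x, ψ x ∂(nu0 m)).toReal) := by
  filter_upwards [key_nat Γ m D hDom hfin hD0 ψ hψm R hψ hintegr] with x hx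
  refine nat_to_real (fun t => (SS Γ ψ t x).toReal) ?_ _ ?_
  · intro a b hab
    refine ENNReal.toReal_mono (SS_ne_top Γ ψ hψt b x) (ENNReal.tsum_le_tsum fun γ => ?_)
    split_ifs with h1 h2
    · exact le_rfl
    · exact absurd (h1.trans hab) h2
    · exact bot_le
    · exact le_rfl
  · have hne : (2 / m D) * ∫⁻ x, ψ x ∂(nu0 m) ≠ ⊤ :=
      ENNReal.mul_ne_top (ENNReal.div_ne_top (by simp) hD0) hintegr
    have := (ENNReal.tendsto_toReal hne).comp hx
    simpa only [Function.comp_def, ENNReal.toReal_div, ENNReal.toReal_natCast] using this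

theorem main_aux (Γ : Subgroup LG) [DiscreteTopology Γ] (m : Measure LG) [m.IsHaarMeasure]
    (D : Set LG) (hD : MeasurableSet D)
    (hfund : ∀ g : LG, ∃! γ : LG, γ ∈ Γ ∧ g * γ ∈ D) (hfin : m D < ⊤) :
    ∃ ν : Measure (Fin 3 → ℝ), ν ≠ 0 ∧ ν.Regular ∧ ν (deSitter 2)ᶜ = 0 ∧
      (∀ g : LG, Measure.map (fun x => mat g *ᵥ x) ν = ν) ∧
      ∀ φ : (Fin 3 → ℝ) → ℝ, Integrable φ ν → HasCompactSupport φ →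
        ∀ᵐ x ∂ν, Tendsto (fun t : ℝ => (1 / t) *
              ∑' γ : {γ : Γ // Real.log (frobNorm (mat (γ : LG))) ≤ t},
                φ (mat ((γ : Γ) : LG)⁻¹ *ᵥ x))
            atTop (nhds (∫ y, φ y ∂ν)) := by
  have hcount := count_disc Γ
  have hDom := dom_op Γ m D hD hfund
  have hD0 : m D ≠ 0 := hDom.measure_ne_zero (NeZero.ne m)
  have hc0 : 2 / m D ≠ 0 := ENNReal.div_ne_zero.2 ⟨by simp, hfin.ne⟩
  have hct : 2 / m D ≠ ⊤ := ENNReal.div_ne_top (by simp) hD0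
  set c := 2 / m D with hc
  have hinv : ∀ g : LG, Measure.map (fun x => mat g *ᵥ x) (c • nu0 m) = c • nu0 m := by
    intro g
    rw [Measure.map_smul, nu0_inv]
  have hae : ∀ p : (Fin 3 → ℝ) → Prop, (∀ᵐ x ∂(c • nu0 m), p x) ↔ ∀ᵐ x ∂(nu0 m), p x := by
    intro p
    rw [Measure.ae_ennreal_smul_measure_eq hc0]
  refine ⟨c • nu0 m, ?_, ?_, ?_, hinv, ?_⟩
  · intro h
    have h1 : (c • nu0 m) Set.univ = 0 := by rw [h]; simp
    rw [Measure.smul_apply, smul_eq_mul, mul_eq_zero] at h1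
    exact nu0_ne m (Measure.measure_univ_eq_zero.1 (h1.resolve_left hc0))
  · have : (nu0 m).Regular := inferInstance
    exact Measure.Regular.smul hct
  · rw [Measure.smul_apply, nu0_dS, smul_zero]
  · intro φ hφ hK
    set ν := c • nu0 m with hν
    obtain ⟨R, hR⟩ := hK.isCompact.isBounded.exists_norm_le
    have hKm : MeasurableSet (tsupport φ) := (isClosed_tsupport φ).measurableSet
    set φ1 := (tsupport φ).indicator (hφ.1.mk φ) with hφ1
    have hφ1m : Measurable φ1 := hφ.1.stronglyMeasurable_mk.measurable.indicator hKm
    have heq : φ =ᵐ[ν] φ1 := by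
      filter_upwards [hφ.1.ae_eq_mk] with x hx
      by_cases hxK : x ∈ tsupport φ
      · rw [hφ1, Set.indicator_of_mem hxK, hx]
      · rw [hφ1, Set.indicator_of_notMem hxK, image_eq_zero_of_notMem_tsupport hxK]
    have hφ1i : Integrable φ1 ν := hφ.congr heq
    have hsupp : ∀ x, φ1 x ≠ 0 → ∀ i, |x i| ≤ R := by
      intro x hx i
      have hxK : x ∈ tsupport φ := by
        by_contra h
        exact hx (Set.indicator_of_notMem h _)
      exact (norm_le_pi_norm x i).trans (hR x hxK)
    have hbd : ∀ (σ : ℝ → ℝ), Measurable σ → (∀ r, |σ r| = |r|) →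
        ∀ᵐ x ∂ν, Tendsto (fun t : ℝ => (SS Γ (fun x => ENNReal.ofReal (σ (φ1 x))) t x).toReal / t)
          atTop (nhds (∫⁻ x, ENNReal.ofReal (σ (φ1 x)) ∂ν).toReal) := by
      intro σ hσ hσa
      have hi : ∫⁻ x, ENNReal.ofReal (σ (φ1 x)) ∂ν ≠ ⊤ := by
        refine ne_top_of_le_ne_top hφ1i.2.ne (lintegral_mono fun x => ?_)
        rw [← ofReal_norm, Real.norm_eq_abs, ← hσa]
        exact ENNReal.ofReal_le_ofReal (le_abs_self _)
      have hmul : ∫⁻ x, ENNReal.ofReal (σ (φ1 x)) ∂ν =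
          c * ∫⁻ x, ENNReal.ofReal (σ (φ1 x)) ∂(nu0 m) := by
        rw [hν, lintegral_smul_measure, smul_eq_mul]
      rw [hmul] at hi ⊢
      rw [hν, hae]
      refine key_real Γ m D hDom hfin hD0 (fun x => ENNReal.ofReal (σ (φ1 x)))
        (hσ.comp hφ1m).ennreal_ofReal (fun x => ENNReal.ofReal_ne_top) R ?_ ?_
      · intro x hx
        apply hsupp
        intro h0
        apply hx
        have h1 := hσa (φ1 x)
        rw [h0, abs_zero, abs_eq_zero] at h1
        show ENNReal.ofReal (σ (φ1 x)) = 0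
        rw [h0, h1, ENNReal.ofReal_zero]
      · intro htop
        rw [htop, ENNReal.mul_top hc0] at hi
        exact hi rfl
    have hall : ∀ᵐ x ∂ν, ∀ γ : Γ, φ (mat (γ : LG)⁻¹ *ᵥ x) = φ1 (mat (γ : LG)⁻¹ *ᵥ x) := by
      rw [ae_all_iff]
      intro γ
      have hmp : MeasurePreserving (fun x => mat (γ : LG)⁻¹ *ᵥ x) ν ν :=
        ⟨mulVec_meas _, hinv _⟩
      exact hmp.quasiMeasurePreserving.ae heq
    have hp := hbd id measurable_id (fun r => rfl)
    have hn := hbd (fun r => -r) measurable_neg (fun r => abs_neg r)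
    rw [integral_congr_ae heq, integral_eq_lintegral_pos_part_sub_lintegral_neg_part hφ1i]
    filter_upwards [hp, hn, hall] with x hxp hxn hxa
    refine (hxp.sub hxn).congr fun t => ?_
    have : Fintype {γ : Γ // Real.log (frobNorm (mat (γ : LG))) ≤ t} := (fin_ball Γ t).fintype
    rw [SS_toReal _ _ (fun _ => ENNReal.ofReal_ne_top), SS_toReal _ _ (fun _ => ENNReal.ofReal_ne_top),
      tsum_fintype, tsum_fintype, tsum_fintype, ← sub_div, ← Finset.sum_sub_distrib, div_eq_inv_mul,
      one_div]
    congr 1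
    refine Finset.sum_congr rfl fun γ _ => ?_
    rw [hxa]
    simp only [ENNReal.toReal_ofReal', id]
    exact max_zero_sub_max_neg_zero_eq_self _

/-- **Equidistribution of lattice orbits on the 2-dimensional de Sitter space
(Arnol'd's problem, d = 2).**
Let Γ be a discrete subgroup of finite covolume of SO(2,1) = Isom(dS₂).  There is a
nonzero SO(2,1)-invariant Radon measure ν on dS₂ such that for every φ ∈ L¹(dS₂,ν) with
compact support and ν-almost every x:
(1/t) Σ_{γ∈Γ, log‖γ‖≤t} φ(γ⁻¹x) → ∫ φ dν as t → ∞. -/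
theorem deSitter_equidistribution_dim_two
    (Γ : Subgroup ↥(lorentzGroup 2)) [DiscreteTopology ↥Γ]
    (m : Measure ↥(lorentzGroup 2)) [m.IsHaarMeasure]
    -- Γ has finite covolume: it admits a Borel fundamental domain of finite Haar measure
    (D : Set ↥(lorentzGroup 2)) (hD : MeasurableSet D)
    (hfund : ∀ g : ↥(lorentzGroup 2), ∃! γ : ↥(lorentzGroup 2), γ ∈ Γ ∧ g * γ ∈ D)
    (hfin : m D < ⊤) :
    ∃ ν : Measure (Fin (2+1) → ℝ), ν ≠ 0 ∧ ν.Regular ∧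
      -- ν is a measure on dS₂ ...
      ν (deSitter 2)ᶜ = 0 ∧
      -- ... invariant under SO(2,1)
      (∀ g : ↥(lorentzGroup 2),
        Measure.map
          (fun x => Matrix.mulVec (((g : SLR 2) : Matrix (Fin (2+1)) (Fin (2+1)) ℝ)) x) ν = ν) ∧
      ∀ φ : (Fin (2+1) → ℝ) → ℝ, Integrable φ ν → HasCompactSupport φ →
        ∀ᵐ x ∂ν,
          Tendsto (fun t : ℝ => (1 / t) *
              ∑' γ : {γ : ↥Γ // Real.log (frobNorm (lmat γ)) ≤ t},
                φ (Matrix.mulVec (lmat ((γ : ↥Γ)⁻¹)) x))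
            atTop (nhds (∫ y, φ y ∂ν)) :=
  main_aux Γ m D hD hfund hfin

end
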